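/- There exists a constant C > 0, independent of Φ, α, n and f, such that for every Φ ≥ 0, every α ≥ 0, every integer n, every admissible right-hand side f, and every smooth solution ψ of the n-th mode problem with Navier boundary conditions, one has n⁴·∫₀¹ |(𝓛ψ)(r)|²·r dr + n⁶·∫₀¹ |(d/dr)(r·ψ(r))|²·(1/r) dr + n⁸·∫₀¹ |ψ(r)|²·r dr ≤ C·(1+Φ)·∫₀¹ |f(r)|²·r dr, and ∫₀¹ |(𝓛²ψ)(r)|²·r dr ≤ C·(1+Φ²)·∫₀¹ |f(r)|²·r dr. (Lemma B.2, higher-order a priori estimates of the stream function in terms of f.) -/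

import Mathlib

open MeasureTheory Filter

/-- One-sided derivative on `(0,1]`. -/
noncomputable def dz (g : ℝ → ℂ) : ℝ → ℂ := derivWithin g (Set.Ioc 0 1)

/-- The operator `(𝓛 g)(r) = g''(r) + (1/r) g'(r) − (1/r²) g(r)`. -/
noncomputable def Lop (g : ℝ → ℂ) : ℝ → ℂ := fun r =>
  dz (dz g) r + ((r : ℂ))⁻¹ * dz g r - (((r : ℂ)) ^ 2)⁻¹ * g r

/-- Weighted integral over `(0,1)` with values in `[0,∞]`. -/
noncomputable def wInt (h : ℝ → ℝ) : ENNReal :=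
  ∫⁻ r in Set.Ioo (0 : ℝ) 1, ENNReal.ofReal (h r)

/-- The Poiseuille profile `Ū(r) = ((4+2α)/(4+α)) (1 − (2α/(4+2α)) r²) (Φ/π)`. -/
noncomputable def Ubar (Φ α : ℝ) : ℝ → ℝ := fun r =>
  (4 + 2 * α) / (4 + α) * (1 - 2 * α / (4 + 2 * α) * r ^ 2) * (Φ / Real.pi)

/-- A smooth solution of the `n`-th mode problem with Navier boundary conditions:
`ψ` is four times continuously differentiable on `(0,1]`; `ψ`, `ψ'`, `𝓛ψ` and
`(d/dr)(r 𝓛ψ)` extend continuously to `[0,1]`;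
`i n Ū (𝓛−n²)ψ − (𝓛−n²)²ψ = f` on `(0,1)`; `ψ(0) = ψ(1) = (𝓛ψ)(0) = 0` and
`(𝓛ψ)(1) = −α ψ'(1)`; and the relevant weighted integrals are finite. -/
structure NavierSol (Φ α : ℝ) (n : ℤ) (f ψ : ℝ → ℂ) : Prop where
  smooth : ContDiffOn ℝ 4 ψ (Set.Ioc 0 1)
  /-- `ψ` extends continuously to `[0,1]` with `ψ(0) = 0`. -/
  ext_psi : Filter.Tendsto ψ (nhdsWithin (0 : ℝ) (Set.Ioc 0 1)) (nhds (0 : ℂ))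
  /-- `ψ'` extends continuously to `[0,1]`. -/
  ext_dpsi : ∃ L : ℂ, Filter.Tendsto (dz ψ) (nhdsWithin (0 : ℝ) (Set.Ioc 0 1)) (nhds L)
  /-- `𝓛ψ` extends continuously to `[0,1]` with `(𝓛ψ)(0) = 0`. -/
  ext_Lpsi : Filter.Tendsto (Lop ψ) (nhdsWithin (0 : ℝ) (Set.Ioc 0 1)) (nhds (0 : ℂ))
  /-- `(d/dr)(r 𝓛ψ)` extends continuously to `[0,1]`. -/
  ext_dLpsi : ∃ L : ℂ, Filter.Tendsto (dz (fun r => (r : ℂ) * Lop ψ r))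
    (nhdsWithin (0 : ℝ) (Set.Ioc 0 1)) (nhds L)
  bc_psi : ψ 1 = 0
  bc_navier : Lop ψ 1 = -(α : ℂ) * dz ψ 1
  eqn : ∀ r ∈ Set.Ioo (0 : ℝ) 1,
    Complex.I * (n : ℂ) * (Ubar Φ α r : ℂ) * (Lop ψ r - (n : ℂ) ^ 2 * ψ r)
      - (Lop (fun s => Lop ψ s - (n : ℂ) ^ 2 * ψ s) r
          - (n : ℂ) ^ 2 * (Lop ψ r - (n : ℂ) ^ 2 * ψ r)) = f r
  fin_psi : wInt (fun r => ‖ψ r‖ ^ 2 * r) < ⊤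
  fin_dpsi : wInt (fun r => ‖dz (fun s => (s : ℂ) * ψ s) r‖ ^ 2 / r) < ⊤
  fin_Lpsi : wInt (fun r => ‖Lop ψ r‖ ^ 2 * r) < ⊤
  fin_dLpsi : wInt (fun r => ‖dz (fun s => (s : ℂ) * Lop ψ s) r‖ ^ 2 / r) < ⊤
  fin_LLpsi : wInt (fun r => ‖Lop (Lop ψ) r‖ ^ 2 * r) < ⊤


open Topology ComplexConjugate

section core

lemma aux_cs {s : Set ℝ} {u v : ℝ → ℝ} (hu : IntegrableOn (fun r => u r ^ 2) s)
    (hv : IntegrableOn (fun r => v r ^ 2) s) (huv : IntegrableOn (fun r => u r * v r) s) :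
    (∫ r in s, u r * v r) ^ 2 ≤ (∫ r in s, u r ^ 2) * (∫ r in s, v r ^ 2) := by
  have key : ∀ t : ℝ, 0 ≤ (∫ r in s, v r ^ 2) * (t * t) + (-2 * ∫ r in s, u r * v r) * t
      + ∫ r in s, u r ^ 2 := by
    intro t
    have h0 : 0 ≤ ∫ r in s, (u r - t * v r) ^ 2 := integral_nonneg fun r => sq_nonneg _
    have h1 : ∫ r in s, (u r - t * v r) ^ 2
        = ∫ r in s, ((t * t) * v r ^ 2 + (-2 * t) * (u r * v r) + u r ^ 2) := by
      congr 1; ext r; ring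
    rw [h1, integral_add, integral_add, integral_const_mul, integral_const_mul] at h0
    · linarith
    · exact hv.const_mul _
    · exact huv.const_mul _
    · exact (hv.const_mul _).add (huv.const_mul _)
    · exact hu
  have := discrim_le_zero key
  unfold discrim at this
  nlinarith

lemma aux_ftc {F F' : ℝ → ℂ} {B : ℂ} (hd : ∀ r ∈ Set.Ioo (0:ℝ) 1, HasDerivAt F (F' r) r)
    (hi : IntegrableOn F' (Set.Ioo 0 1)) (h0 : Tendsto F (𝓝[>] 0) (𝓝 0))
    (h1 : Tendsto F (𝓝[<] 1) (𝓝 B)) : ∫ r in Set.Ioo (0:ℝ) 1, F' r = B := by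
  have := intervalIntegral.integral_eq_sub_of_hasDerivAt_of_tendsto (by norm_num : (0:ℝ) < 1) hd
    ((intervalIntegrable_iff_integrableOn_Ioo_of_le (by norm_num)).2 hi) h0 h1
  rw [intervalIntegral.integral_of_le (by norm_num), integral_Ioc_eq_integral_Ioo] at this
  simpa using this

/-- continuity and weighted square integrability -/
structure L2r (u : ℝ → ℂ) : Prop where
  c : ContinuousOn u (Set.Ioo 0 1)
  i : IntegrableOn (fun r => ‖u r‖ ^ 2 * r) (Set.Ioo 0 1)

lemma L2r.prod {u v : ℝ → ℂ} (hu : L2r u) (hv : L2r v) {m : ℝ → ℂ} {K : ℝ}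
    (hm : ContinuousOn m (Set.Ioo 0 1)) (hK : ∀ r ∈ Set.Ioo (0:ℝ) 1, ‖m r‖ ≤ K) :
    IntegrableOn (fun r => m r * (u r * conj (v r)) * (r:ℂ)) (Set.Ioo 0 1) := by
  have hb : IntegrableOn (fun r => K * (‖u r‖ ^ 2 * r + ‖v r‖ ^ 2 * r)) (Set.Ioo 0 1) :=
    (hu.i.add hv.i).const_mul K
  refine Integrable.mono' hb ?_ ?_
  · refine ContinuousOn.aestronglyMeasurable ?_ measurableSet_Ioo
    have := hu.c
    have h2 : ContinuousOn (fun r => conj (v r)) (Set.Ioo 0 1) :=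
      Complex.continuous_conj.comp_continuousOn hv.c
    fun_prop
  · refine (ae_restrict_iff' measurableSet_Ioo).2 (Eventually.of_forall fun r hr => ?_)
    have h0 := hr.1
    simp only [norm_mul, RCLike.norm_conj, Complex.norm_real, Real.norm_eq_abs, abs_of_pos h0]
    have := hK r hr
    have hm0 := norm_nonneg (m r)
    have h3 : ‖u r‖ * ‖v r‖ ≤ ‖u r‖ ^ 2 + ‖v r‖ ^ 2 := by nlinarith [sq_nonneg (‖u r‖ - ‖v r‖)]
    calc ‖m r‖ * (‖u r‖ * ‖v r‖) * r ≤ K * (‖u r‖ ^ 2 + ‖v r‖ ^ 2) * r := by gcongr; linarith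
      _ = _ := by ring

lemma L2r.prod1 {u v : ℝ → ℂ} (hu : L2r u) (hv : L2r v) :
    IntegrableOn (fun r => (u r * conj (v r)) * (r:ℂ)) (Set.Ioo 0 1) := by
  simpa using hu.prod hv (m := fun _ => 1) (K := 1) continuousOn_const (by simp)

lemma L2r.rprod {u v : ℝ → ℂ} (hu : L2r u) (hv : L2r v) {m : ℝ → ℝ} {K : ℝ}
    (hm : ContinuousOn m (Set.Ioo 0 1)) (hK : ∀ r ∈ Set.Ioo (0:ℝ) 1, |m r| ≤ K) :
    IntegrableOn (fun r => m r * (‖u r‖ * ‖v r‖) * r) (Set.Ioo 0 1) := by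
  have := (hu.prod hv (m := fun _ => 1) (K := 1) continuousOn_const (by simp)).norm
  have h2 : IntegrableOn (fun r => K * ‖1 * (u r * conj (v r)) * (r:ℂ)‖) (Set.Ioo 0 1) :=
    this.const_mul K
  refine Integrable.mono' h2 ?_ ?_
  · refine ContinuousOn.aestronglyMeasurable ?_ measurableSet_Ioo
    have := hu.c
    have := hv.c
    fun_prop
  · refine (ae_restrict_iff' measurableSet_Ioo).2 (Eventually.of_forall fun r hr => ?_)
    have h0 := hr.1
    simp only [norm_mul, RCLike.norm_conj, Complex.norm_real, Real.norm_eq_abs, abs_of_pos h0,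
      one_mul, abs_norm]
    rw [mul_assoc]
    have := hK r hr
    gcongr

lemma L2r.sub {u v : ℝ → ℂ} (hu : L2r u) (hv : L2r v) (k : ℂ) :
    L2r (fun r => u r - k * v r) := by
  refine ⟨?_, ?_⟩
  · have := hu.c
    have := hv.c
    fun_prop
  · have hb : IntegrableOn (fun r => 2 * (‖u r‖ ^ 2 * r) + 2 * ‖k‖ ^ 2 * (‖v r‖ ^ 2 * r))
      (Set.Ioo 0 1) := (hu.i.const_mul _).add (hv.i.const_mul _)
    refine Integrable.mono' hb ?_ ?_
    · refine ContinuousOn.aestronglyMeasurable ?_ measurableSet_Ioo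
      have := hu.c
      have := hv.c
      fun_prop
    · refine (ae_restrict_iff' measurableSet_Ioo).2 (Eventually.of_forall fun r hr => ?_)
      have h0 := hr.1
      have h1 : ‖u r - k * v r‖ ≤ ‖u r‖ + ‖k‖ * ‖v r‖ := by
        simpa using norm_sub_le (u r) (k * v r)
      have h2 := norm_nonneg (u r - k * v r)
      rw [Real.norm_of_nonneg (by positivity)]
      have h3 : ‖u r - k * v r‖ ^ 2 ≤ 2 * ‖u r‖ ^ 2 + 2 * ‖k‖ ^ 2 * ‖v r‖ ^ 2 := by
        nlinarith [sq_nonneg (‖u r‖ - ‖k‖ * ‖v r‖)]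
      nlinarith

lemma L2r.cs {u v : ℝ → ℂ} (hu : L2r u) (hv : L2r v) :
    (∫ r in Set.Ioo (0:ℝ) 1, ‖u r‖ * ‖v r‖ * r) ^ 2
      ≤ (∫ r in Set.Ioo (0:ℝ) 1, ‖u r‖ ^ 2 * r) * ∫ r in Set.Ioo (0:ℝ) 1, ‖v r‖ ^ 2 * r := by
  have e : ∀ w : ℝ → ℂ, Set.EqOn (fun r => ‖w r‖ ^ 2 * r) (fun r => (‖w r‖ * √r) ^ 2)
      (Set.Ioo 0 1) := fun w r hr => by
    simp only [mul_pow, Real.sq_sqrt hr.1.le]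
  have e2 : Set.EqOn (fun r => ‖u r‖ * ‖v r‖ * r) (fun r => (‖u r‖ * √r) * (‖v r‖ * √r))
      (Set.Ioo 0 1) := fun r hr => by
    have := Real.mul_self_sqrt hr.1.le
    simp only
    linear_combination (-‖u r‖ * ‖v r‖) * this
  rw [setIntegral_congr_fun measurableSet_Ioo (e u), setIntegral_congr_fun measurableSet_Ioo (e v),
    setIntegral_congr_fun measurableSet_Ioo e2]
  refine aux_cs (hu.i.congr_fun (e u) measurableSet_Ioo) (hv.i.congr_fun (e v) measurableSet_Ioo) ?_
  refine IntegrableOn.congr_fun ?_ e2 measurableSet_Ioo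
  simpa using hu.rprod hv (m := fun _ => 1) (K := 1) continuousOn_const (by simp)

lemma L2r.sq {u : ℝ → ℂ} :
    (∫ r in Set.Ioo (0:ℝ) 1, (u r * conj (u r)) * (r:ℂ))
      = ((∫ r in Set.Ioo (0:ℝ) 1, ‖u r‖ ^ 2 * r : ℝ) : ℂ) := by
  rw [← integral_complex_ofReal]
  congr 1; ext r
  rw [Complex.mul_conj, Complex.normSq_eq_norm_sq]; push_cast; ring


/-- slope constant of the profile -/
noncomputable def cU (Φ α : ℝ) : ℝ := 4 * α / (4 + α) * (Φ / Real.pi)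

lemma Ubar_deriv (Φ : ℝ) {α : ℝ} (hα : 0 ≤ α) (r : ℝ) :
    HasDerivAt (Ubar Φ α) (-(cU Φ α * r)) r := by
  unfold Ubar cU
  have h : HasDerivAt (fun r : ℝ => r ^ 2) (2 * r) r := by simpa using hasDerivAt_pow 2 r
  refine (((((h.const_mul (2 * α / (4 + 2 * α))).const_sub 1).const_mul
    ((4 + 2 * α) / (4 + α))).mul_const (Φ / Real.pi))).congr_deriv ?_
  have : 4 + α ≠ 0 := by positivity
  have : 4 + 2 * α ≠ 0 := by positivity
  have := Real.pi_ne_zero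
  field_simp
  ring

lemma Ubar_eq (Φ : ℝ) {α : ℝ} (hα : 0 ≤ α) (r : ℝ) :
    Ubar Φ α r = (4 + 2 * α * (1 - r ^ 2)) / (4 + α) * (Φ / Real.pi) := by
  unfold Ubar
  have : 4 + α ≠ 0 := by positivity
  have : 4 + 2 * α ≠ 0 := by positivity
  field_simp
  ring

lemma Ubar_lower {Φ α : ℝ} (hΦ : 0 ≤ Φ) (hα : 0 ≤ α) {r : ℝ} (hr : r ∈ Set.Ioo (0:ℝ) 1) :
    Φ / Real.pi * (1 - r ^ 2) ≤ Ubar Φ α r := by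
  rw [Ubar_eq Φ hα, mul_comm]
  have : 0 ≤ Φ / Real.pi := by positivity
  gcongr
  rw [le_div_iff₀ (by positivity)]
  have h1 : r ^ 2 ≤ 1 := by nlinarith [hr.1, hr.2]
  nlinarith [mul_nonneg hα (sub_nonneg.2 h1), sq_nonneg r]

lemma Ubar_upper {Φ α : ℝ} (hΦ : 0 ≤ Φ) (hα : 0 ≤ α) {r : ℝ} (hr : r ∈ Set.Ioo (0:ℝ) 1) :
    |Ubar Φ α r| ≤ Φ := by
  have h1 : r ^ 2 ≤ 1 := by nlinarith [hr.1, hr.2]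
  have h0 : 0 ≤ Φ / Real.pi := by positivity
  rw [abs_of_nonneg ((mul_nonneg h0 (by linarith)).trans (Ubar_lower hΦ hα hr)), Ubar_eq Φ hα]
  have h2 : (4 + 2 * α * (1 - r ^ 2)) / (4 + α) ≤ 2 := by
    rw [div_le_iff₀ (by positivity)]
    nlinarith [mul_nonneg hα (sq_nonneg r)]
  calc _ ≤ 2 * (Φ / Real.pi) := by gcongr
    _ ≤ Φ := by
      rw [← mul_div_assoc, div_le_iff₀ Real.pi_pos]
      nlinarith [Real.pi_gt_three]

lemma cU_nonneg {Φ α : ℝ} (hΦ : 0 ≤ Φ) (hα : 0 ≤ α) : 0 ≤ cU Φ α := by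
  unfold cU; positivity

lemma cU_le {Φ α : ℝ} (hΦ : 0 ≤ Φ) (hα : 0 ≤ α) : cU Φ α ≤ 4 * (Φ / Real.pi) := by
  unfold cU
  have : 0 ≤ Φ / Real.pi := by positivity
  gcongr
  rw [div_le_iff₀ (by positivity)]; linarith

/-- The first order system extracted from the mode problem, with `P = (rψ)'/r`, `ω = 𝓛ψ`,
`Q = (rω)'/r`. -/
structure Core (Φ α : ℝ) (n : ℤ) (f ψ P ω Q : ℝ → ℂ) : Prop where
  hΦ : 0 ≤ Φ
  hα : 0 ≤ α
  d1 : ∀ r ∈ Set.Ioo (0:ℝ) 1, HasDerivAt ψ (P r - ψ r / r) r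
  d2 : ∀ r ∈ Set.Ioo (0:ℝ) 1, HasDerivAt P (ω r) r
  d3 : ∀ r ∈ Set.Ioo (0:ℝ) 1, HasDerivAt ω (Q r - ω r / r) r
  d4 : ∀ r ∈ Set.Ioo (0:ℝ) 1, HasDerivAt Q ((n:ℂ) ^ 2 * ω r + (n:ℂ) ^ 2 * (ω r - (n:ℂ) ^ 2 * ψ r)
    + Complex.I * (n:ℂ) * (Ubar Φ α r : ℂ) * (ω r - (n:ℂ) ^ 2 * ψ r) - f r) r
  lf : L2r f
  lψ : L2r ψ
  lP : L2r P
  lω : L2r ω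
  z1 : Tendsto ψ (𝓝[>] 0) (𝓝 0)
  z2 : Tendsto (fun r : ℝ => (r:ℂ) * P r) (𝓝[>] 0) (𝓝 0)
  z3 : Tendsto ω (𝓝[>] 0) (𝓝 0)
  z4 : ∃ l, Tendsto (fun r : ℝ => (r:ℂ) * Q r) (𝓝[>] 0) (𝓝 l)
  o1 : Tendsto ψ (𝓝[<] 1) (𝓝 0)
  o2 : ∃ p, Tendsto P (𝓝[<] 1) (𝓝 p) ∧ Tendsto ω (𝓝[<] 1) (𝓝 (-(α:ℂ) * p))
  o4 : ∃ q, Tendsto Q (𝓝[<] 1) (𝓝 q)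

lemma HD.ofReal (r : ℝ) : HasDerivAt (fun r : ℝ => (r:ℂ)) 1 r := Complex.ofRealCLM.hasDerivAt

lemma HD.conj {u : ℝ → ℂ} {u' : ℂ} {r : ℝ} (h : HasDerivAt u u' r) :
    HasDerivAt (fun r => conj (u r)) (conj u') r := h.star

lemma tend_conj {u : ℝ → ℂ} {l : Filter ℝ} {a : ℂ} (h : Tendsto u l (𝓝 a)) :
    Tendsto (fun r => conj (u r)) l (𝓝 (conj a)) :=
  (Complex.continuous_conj.tendsto a).comp h

lemma tend_r0 : Tendsto (fun r : ℝ => (r:ℂ)) (𝓝[>] 0) (𝓝 0) := by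
  have := (Complex.continuous_ofReal.tendsto 0).mono_left (nhdsWithin_le_nhds (s := Set.Ioi 0))
  simpa using this

lemma tend_r1 : Tendsto (fun r : ℝ => (r:ℂ)) (𝓝[<] 1) (𝓝 1) := by
  have := (Complex.continuous_ofReal.tendsto 1).mono_left (nhdsWithin_le_nhds (s := Set.Iio 1))
  simpa using this

section
variable {Φ α : ℝ} {n : ℤ} {f ψ P ω Q : ℝ → ℂ}

lemma Core.contU (_h : Core Φ α n f ψ P ω Q) : ContinuousOn (fun r => (Ubar Φ α r : ℂ)) (Set.Ioo 0 1) := by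
  unfold Ubar; fun_prop

lemma Core.bU (h : Core Φ α n f ψ P ω Q) : ∀ r ∈ Set.Ioo (0:ℝ) 1, ‖(Ubar Φ α r : ℂ)‖ ≤ Φ := by
  intro r hr
  simpa using Ubar_upper h.hΦ h.hα hr

lemma Core.lw (h : Core Φ α n f ψ P ω Q) : L2r (fun r => ω r - (n:ℂ) ^ 2 * ψ r) :=
  h.lω.sub h.lψ _

lemma Core.E1 (h : Core Φ α n f ψ P ω Q) : ∃ s : ℝ, 0 ≤ s ∧
    -(∫ r in Set.Ioo (0:ℝ) 1, ((ω r - (n:ℂ) ^ 2 * ψ r) * conj (ω r - (n:ℂ) ^ 2 * ψ r)) * (r:ℂ))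
    + Complex.I * n * (∫ r in Set.Ioo (0:ℝ) 1,
        (Ubar Φ α r : ℂ) * ((ω r - (n:ℂ) ^ 2 * ψ r) * conj (ψ r)) * (r:ℂ))
    - (∫ r in Set.Ioo (0:ℝ) 1, (f r * conj (ψ r)) * (r:ℂ)) = (s:ℂ) := by
  obtain ⟨p, hp, hp'⟩ := h.o2
  obtain ⟨q, hq⟩ := h.o4
  obtain ⟨l, hl⟩ := h.z4
  refine ⟨α * ‖p‖ ^ 2, mul_nonneg h.hα (by positivity), ?_⟩
  have i1 := h.lw.prod1 h.lw
  have i2 := h.lw.prod h.lψ h.contU h.bU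
  have i3 := h.lf.prod1 h.lψ
  rw [← integral_neg, ← integral_const_mul, ← integral_add, ← integral_sub _ i3]
  rotate_left
  · exact i1.neg.add (i2.const_mul _)
  · exact i1.neg
  · exact i2.const_mul _
  refine aux_ftc (F := fun r => (r:ℂ) * (Q r - (n:ℂ) ^ 2 * P r) * conj (ψ r)
    - (ω r - (n:ℂ) ^ 2 * ψ r) * conj ((r:ℂ) * P r)) ?_ ((i1.neg.add (i2.const_mul _)).sub i3) ?_ ?_
  · intro r hr
    have hr0 : (r:ℂ) ≠ 0 := by exact_mod_cast hr.1.ne'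
    have := (((HD.ofReal r).mul ((h.d4 r hr).sub ((h.d2 r hr).const_mul ((n:ℂ) ^ 2)))).mul
      (HD.conj (h.d1 r hr))).sub (((h.d3 r hr).sub ((h.d1 r hr).const_mul ((n:ℂ) ^ 2))).mul
      (HD.conj ((HD.ofReal r).mul (h.d2 r hr))))
    refine this.congr_deriv ?_
    simp only [map_sub, map_mul, map_add, map_one, map_div₀, Complex.conj_ofReal, map_pow,
      map_intCast, Pi.mul_apply, Pi.sub_apply]
    field_simp
    ring
  · have := (((hl.sub (h.z2.const_mul ((n:ℂ) ^ 2))).mul (tend_conj h.z1))).sub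
      ((h.z3.sub (h.z1.const_mul ((n:ℂ) ^ 2))).mul (tend_conj h.z2))
    simp only [map_zero, mul_zero, sub_zero] at this
    refine this.congr fun r => ?_
    ring
  · have := ((tend_r1.mul (hq.sub (hp.const_mul ((n:ℂ) ^ 2)))).mul (tend_conj h.o1)).sub
      ((hp'.sub (h.o1.const_mul ((n:ℂ) ^ 2))).mul (tend_conj (tend_r1.mul hp)))
    convert this using 2
    simp only [map_zero, mul_zero, sub_zero, one_mul, zero_sub]
    rw [mul_assoc, Complex.mul_conj, Complex.normSq_eq_norm_sq]
    push_cast; ring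

lemma Core.E2 (h : Core Φ α n f ψ P ω Q) :
    (∫ r in Set.Ioo (0:ℝ) 1, (Ubar Φ α r : ℂ) * ((ω r - (n:ℂ) ^ 2 * ψ r) * conj (ψ r)) * (r:ℂ))
    = -((∫ r in Set.Ioo (0:ℝ) 1, Ubar Φ α r * (‖P r‖ ^ 2 + (n:ℝ) ^ 2 * ‖ψ r‖ ^ 2) * r : ℝ) : ℂ)
      + cU Φ α * ∫ r in Set.Ioo (0:ℝ) 1, (r:ℂ) * (P r * conj (ψ r)) * (r:ℂ) := by
  have i1 := h.lP.prod h.lP h.contU h.bU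
  have i2 := h.lψ.prod h.lψ h.contU h.bU
  have i3 := h.lw.prod h.lψ h.contU h.bU
  have i4 : IntegrableOn (fun r : ℝ => (r:ℂ) * (P r * conj (ψ r)) * (r:ℂ)) (Set.Ioo 0 1) :=
    h.lP.prod h.lψ (m := fun r => (r:ℂ)) (K := 1) (by fun_prop)
      (fun r hr => by simpa [abs_of_pos hr.1] using hr.2.le)
  have e : ((∫ r in Set.Ioo (0:ℝ) 1, Ubar Φ α r * (‖P r‖ ^ 2 + (n:ℝ) ^ 2 * ‖ψ r‖ ^ 2) * r : ℝ) : ℂ)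
      = ∫ r in Set.Ioo (0:ℝ) 1, ((Ubar Φ α r : ℂ) * (P r * conj (P r)) * (r:ℂ)
        + (n:ℂ) ^ 2 * ((Ubar Φ α r : ℂ) * (ψ r * conj (ψ r)) * (r:ℂ))) := by
    rw [← integral_complex_ofReal]
    congr 1; ext r
    rw [Complex.mul_conj, Complex.normSq_eq_norm_sq, Complex.mul_conj, Complex.normSq_eq_norm_sq]
    push_cast; ring
  have key := aux_ftc (F := fun r => (Ubar Φ α r : ℂ) * ((r:ℂ) * P r) * conj (ψ r))
    (F' := fun r => ((Ubar Φ α r : ℂ) * ((ω r - (n:ℂ) ^ 2 * ψ r) * conj (ψ r)) * (r:ℂ)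
      + ((Ubar Φ α r : ℂ) * (P r * conj (P r)) * (r:ℂ)
        + (n:ℂ) ^ 2 * ((Ubar Φ α r : ℂ) * (ψ r * conj (ψ r)) * (r:ℂ))))
      - cU Φ α * ((r:ℂ) * (P r * conj (ψ r)) * (r:ℂ))) (B := 0) ?_
      ((i3.add (i1.add (i2.const_mul _))).sub (i4.const_mul _)) ?_ ?_
  · rw [integral_sub, integral_add i3, integral_const_mul, ← e] at key
    · linear_combination key
    · exact (i1.add (i2.const_mul _))
    · exact (i3.add (i1.add (i2.const_mul _)))
    · exact (i4.const_mul _)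
  · intro r hr
    have hr0 : (r:ℂ) ≠ 0 := by exact_mod_cast hr.1.ne'
    have := (((Ubar_deriv Φ h.hα r).ofReal_comp).mul ((HD.ofReal r).mul (h.d2 r hr))).mul
      (HD.conj (h.d1 r hr))
    refine this.congr_deriv ?_
    simp only [map_sub, map_div₀, Complex.conj_ofReal, Pi.mul_apply]
    push_cast
    field_simp
    ring
  · have := ((((Complex.continuous_ofReal.tendsto _).comp
      (Ubar_deriv Φ h.hα 0).continuousAt.tendsto).mono_left
      (nhdsWithin_le_nhds (s := Set.Ioi 0))).mul h.z2).mul (tend_conj h.z1)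
    simpa using this
  · obtain ⟨p, hp, hp'⟩ := h.o2
    have := ((((Complex.continuous_ofReal.tendsto _).comp
      (Ubar_deriv Φ h.hα 1).continuousAt.tendsto).mono_left
      (nhdsWithin_le_nhds (s := Set.Iio 1))).mul (tend_r1.mul hp)).mul (tend_conj h.o1)
    simpa using this

lemma Core.E3 (h : Core Φ α n f ψ P ω Q) :
    (∫ r in Set.Ioo (0:ℝ) 1, (r:ℂ) * (P r * conj (ψ r)) * (r:ℂ)).re = 0 := by
  have i4 : IntegrableOn (fun r : ℝ => (r:ℂ) * (P r * conj (ψ r)) * (r:ℂ)) (Set.Ioo 0 1) :=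
    h.lP.prod h.lψ (m := fun r => (r:ℂ)) (K := 1) (by fun_prop)
      (fun r hr => by simpa [abs_of_pos hr.1] using hr.2.le)
  have i5 : IntegrableOn (fun r : ℝ => (r:ℂ) * (ψ r * conj (P r)) * (r:ℂ)) (Set.Ioo 0 1) :=
    h.lψ.prod h.lP (m := fun r => (r:ℂ)) (K := 1) (by fun_prop)
      (fun r hr => by simpa [abs_of_pos hr.1] using hr.2.le)
  have key := aux_ftc (F := fun r => ((r:ℂ) * ψ r) * conj ((r:ℂ) * ψ r)) (B := 0) ?_
    (i4.add i5) ?_ ?_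
  · have e : (∫ r in Set.Ioo (0:ℝ) 1, (r:ℂ) * (ψ r * conj (P r)) * (r:ℂ))
        = conj (∫ r in Set.Ioo (0:ℝ) 1, (r:ℂ) * (P r * conj (ψ r)) * (r:ℂ)) := by
      rw [← integral_conj]
      congr 1; ext r
      simp only [map_mul, Complex.conj_conj, Complex.conj_ofReal]; ring
    have key2 : (∫ r in Set.Ioo (0:ℝ) 1, (r:ℂ) * (P r * conj (ψ r)) * (r:ℂ))
       + (∫ r in Set.Ioo (0:ℝ) 1, (r:ℂ) * (ψ r * conj (P r)) * (r:ℂ)) = 0 := by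
      rw [← integral_add i4 i5]; exact key
    rw [e] at key2
    have := congrArg Complex.re key2
    simp only [Complex.add_re, Complex.conj_re, Complex.zero_re] at this
    linarith
  · intro r hr
    have hr0 : (r:ℂ) ≠ 0 := by exact_mod_cast hr.1.ne'
    have := ((HD.ofReal r).mul (h.d1 r hr)).mul (HD.conj ((HD.ofReal r).mul (h.d1 r hr)))
    refine this.congr_deriv ?_
    simp only [map_sub, map_div₀, Complex.conj_ofReal, Pi.mul_apply, Pi.add_apply, map_mul, map_add, map_one]
    field_simp
    ring
  · simpa using (tend_r0.mul h.z1).mul (tend_conj (tend_r0.mul h.z1))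
  · simpa using (tend_r1.mul h.o1).mul (tend_conj (tend_r1.mul h.o1))

lemma Core.E4 (h : Core Φ α n f ψ P ω Q) :
    (∫ r in Set.Ioo (0:ℝ) 1, (ω r * conj (ψ r)) * (r:ℂ))
     = -((∫ r in Set.Ioo (0:ℝ) 1, ‖P r‖ ^ 2 * r : ℝ) : ℂ) := by
  have i1 := h.lω.prod1 h.lψ
  have i2 := h.lP.prod1 h.lP
  have key := aux_ftc (F := fun r => ((r:ℂ) * P r) * conj (ψ r)) (B := 0) ?_ (i1.add i2) ?_ ?_
  · have key2 : (∫ r in Set.Ioo (0:ℝ) 1, (ω r * conj (ψ r)) * (r:ℂ))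
       + (∫ r in Set.Ioo (0:ℝ) 1, (P r * conj (P r)) * (r:ℂ)) = 0 := by
      rw [← integral_add i1 i2]; exact key
    rw [L2r.sq] at key2
    linear_combination key2
  · intro r hr
    have hr0 : (r:ℂ) ≠ 0 := by exact_mod_cast hr.1.ne'
    have := ((HD.ofReal r).mul (h.d2 r hr)).mul (HD.conj (h.d1 r hr))
    refine this.congr_deriv ?_
    simp only [map_sub, map_div₀, Complex.conj_ofReal, Pi.mul_apply, Pi.add_apply]
    field_simp
    ring
  · simpa using h.z2.mul (tend_conj h.z1)
  · obtain ⟨p, hp, hp'⟩ := h.o2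
    simpa using (tend_r1.mul hp).mul (tend_conj h.o1)

lemma Core.E4' (h : Core Φ α n f ψ P ω Q) :
    (∫ r in Set.Ioo (0:ℝ) 1, ‖ω r - (n:ℂ) ^ 2 * ψ r‖ ^ 2 * r)
     = (∫ r in Set.Ioo (0:ℝ) 1, ‖ω r‖ ^ 2 * r) + 2 * (n:ℝ) ^ 2 * (∫ r in Set.Ioo (0:ℝ) 1, ‖P r‖ ^ 2 * r)
      + (n:ℝ) ^ 4 * ∫ r in Set.Ioo (0:ℝ) 1, ‖ψ r‖ ^ 2 * r := by
  have i1 := h.lω.prod1 h.lψ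
  have i2 := h.lω.prod1 h.lω
  have i3 := h.lψ.prod1 h.lψ
  have i4 := h.lψ.prod1 h.lω
  have e : (∫ r in Set.Ioo (0:ℝ) 1, (ψ r * conj (ω r)) * (r:ℂ))
        = conj (∫ r in Set.Ioo (0:ℝ) 1, (ω r * conj (ψ r)) * (r:ℂ)) := by
      rw [← integral_conj]
      congr 1; ext r
      simp only [map_mul, Complex.conj_conj, Complex.conj_ofReal]; ring
  rw [h.E4] at e
  simp only [map_neg, Complex.conj_ofReal] at e
  apply Complex.ofReal_injective
  push_cast
  rw [← L2r.sq (u := ω), ← L2r.sq (u := ψ), ← L2r.sq (u := fun r => ω r - (n:ℂ) ^ 2 * ψ r)]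
  have e3 : ∫ r in Set.Ioo (0:ℝ) 1, ((ω r - (n:ℂ) ^ 2 * ψ r) * conj (ω r - (n:ℂ) ^ 2 * ψ r)) * (r:ℂ)
     = ∫ r in Set.Ioo (0:ℝ) 1, ((ω r * conj (ω r)) * (r:ℂ)
      - (n:ℂ) ^ 2 * ((ω r * conj (ψ r)) * (r:ℂ)) - (n:ℂ) ^ 2 * ((ψ r * conj (ω r)) * (r:ℂ))
      + (n:ℂ) ^ 4 * ((ψ r * conj (ψ r)) * (r:ℂ))) := by
    congr 1; ext r
    simp only [map_sub, map_mul, map_pow, map_intCast]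
    ring
  rw [e3, integral_add, integral_sub, integral_sub i2, integral_const_mul, integral_const_mul,
    integral_const_mul, e, h.E4]
  · ring
  · exact i1.const_mul _
  · exact i2.sub (i1.const_mul _)
  · exact i4.const_mul _
  · exact (i2.sub (i1.const_mul _)).sub (i4.const_mul _)
  · exact i3.const_mul _

end

section
variable {Φ α : ℝ} {n : ℤ} {f ψ P ω Q : ℝ → ℂ}

lemma abs_le_one_r {r : ℝ} (hr : r ∈ Set.Ioo (0:ℝ) 1) : |r| ≤ 1 := by
  rw [abs_of_pos hr.1]; exact hr.2.le

lemma abs_le_one_s {r : ℝ} (hr : r ∈ Set.Ioo (0:ℝ) 1) : |1 - r ^ 2| ≤ 1 := by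
  rw [abs_of_nonneg] <;> nlinarith [hr.1, hr.2]

lemma abs_le_one_rs {r : ℝ} (hr : r ∈ Set.Ioo (0:ℝ) 1) : |(1 - r ^ 2) * r| ≤ 1 := by
  rw [abs_mul]; exact mul_le_one₀ (abs_le_one_s hr) (abs_nonneg _) (abs_le_one_r hr)

lemma abs_le_one_r2 {r : ℝ} (hr : r ∈ Set.Ioo (0:ℝ) 1) : |r ^ 2| ≤ 1 := by
  rw [abs_of_nonneg] <;> nlinarith [hr.1, hr.2]

lemma L2r.norm_le {u v : ℝ → ℂ} (hu : L2r u) (hv : L2r v) :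
    ‖∫ r in Set.Ioo (0:ℝ) 1, (u r * conj (v r)) * (r:ℂ)‖
      ≤ √(∫ r in Set.Ioo (0:ℝ) 1, ‖u r‖ ^ 2 * r) * √(∫ r in Set.Ioo (0:ℝ) 1, ‖v r‖ ^ 2 * r) := by
  have h0 : ∀ w : ℝ → ℂ, 0 ≤ ∫ r in Set.Ioo (0:ℝ) 1, ‖w r‖ ^ 2 * r := fun w =>
    setIntegral_nonneg measurableSet_Ioo fun r hr => mul_nonneg (by positivity) hr.1.le
  calc _ ≤ ∫ r in Set.Ioo (0:ℝ) 1, ‖(u r * conj (v r)) * (r:ℂ)‖ := norm_integral_le_integral_norm _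
    _ = ∫ r in Set.Ioo (0:ℝ) 1, ‖u r‖ * ‖v r‖ * r :=
      setIntegral_congr_fun measurableSet_Ioo fun r hr => by simp [abs_of_pos hr.1]
    _ ≤ _ := by
      rw [← Real.sqrt_mul (h0 u)]
      exact Real.le_sqrt_of_sq_le (hu.cs hv)

lemma Core.iX (h : Core Φ α n f ψ P ω Q) : IntegrableOn
    (fun r => Ubar Φ α r * (‖P r‖ ^ 2 + (n:ℝ) ^ 2 * ‖ψ r‖ ^ 2) * r) (Set.Ioo 0 1) := by
  have cU : ContinuousOn (Ubar Φ α) (Set.Ioo 0 1) := by unfold Ubar; fun_prop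
  have i1 := h.lP.rprod h.lP cU (fun r hr => Ubar_upper h.hΦ h.hα hr)
  have i2 := h.lψ.rprod h.lψ cU (fun r hr => Ubar_upper h.hΦ h.hα hr)
  refine (i1.add (i2.const_mul ((n:ℝ)^2))).congr_fun (fun r _ => ?_) measurableSet_Ioo
  simp only [Pi.add_apply]; ring

lemma Core.iA (h : Core Φ α n f ψ P ω Q) : IntegrableOn
    (fun r => (1 - r ^ 2) * ‖P r‖ ^ 2 * r) (Set.Ioo 0 1) := by
  refine (h.lP.rprod h.lP (m := fun r => 1 - r ^ 2) (K := 1) (by fun_prop)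
    (fun r hr => abs_le_one_s hr)).congr_fun (fun r _ => ?_) measurableSet_Ioo
  ring

lemma Core.iB (h : Core Φ α n f ψ P ω Q) : IntegrableOn
    (fun r => (1 - r ^ 2) * ‖ψ r‖ ^ 2 * r) (Set.Ioo 0 1) := by
  refine (h.lψ.rprod h.lψ (m := fun r => 1 - r ^ 2) (K := 1) (by fun_prop)
    (fun r hr => abs_le_one_s hr)).congr_fun (fun r _ => ?_) measurableSet_Ioo
  ring

lemma Core.iY (h : Core Φ α n f ψ P ω Q) : IntegrableOn
    (fun r => r * (‖P r‖ * ‖ψ r‖) * r) (Set.Ioo 0 1) :=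
  h.lP.rprod h.lψ (m := fun r => r) (K := 1) (by fun_prop) (fun r hr => abs_le_one_r hr)

lemma Core.I12 (h : Core Φ α n f ψ P ω Q) :
    |(n:ℝ)| * (∫ r in Set.Ioo (0:ℝ) 1, Ubar Φ α r * (‖P r‖ ^ 2 + (n:ℝ) ^ 2 * ‖ψ r‖ ^ 2) * r)
      ≤ √(∫ r in Set.Ioo (0:ℝ) 1, ‖f r‖ ^ 2 * r) * √(∫ r in Set.Ioo (0:ℝ) 1, ‖ψ r‖ ^ 2 * r) ∧
    (∫ r in Set.Ioo (0:ℝ) 1, ‖ω r - (n:ℂ) ^ 2 * ψ r‖ ^ 2 * r)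
      ≤ |(n:ℝ)| * (cU Φ α * ∫ r in Set.Ioo (0:ℝ) 1, r * (‖P r‖ * ‖ψ r‖) * r)
       + √(∫ r in Set.Ioo (0:ℝ) 1, ‖f r‖ ^ 2 * r) * √(∫ r in Set.Ioo (0:ℝ) 1, ‖ψ r‖ ^ 2 * r) := by
  obtain ⟨s, hs, e1⟩ := h.E1
  rw [h.E2, L2r.sq (u := fun r => ω r - (n:ℂ) ^ 2 * ψ r)] at e1
  have e3 := h.E3
  have hn := h.lf.norm_le h.lψ
  have hY : ‖∫ r in Set.Ioo (0:ℝ) 1, (r:ℂ) * (P r * conj (ψ r)) * (r:ℂ)‖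
      ≤ ∫ r in Set.Ioo (0:ℝ) 1, r * (‖P r‖ * ‖ψ r‖) * r := by
    refine (norm_integral_le_integral_norm _).trans_eq ?_
    exact setIntegral_congr_fun measurableSet_Ioo fun r hr => by simp [abs_of_pos hr.1]
  have hX0 : 0 ≤ ∫ r in Set.Ioo (0:ℝ) 1, Ubar Φ α r * (‖P r‖ ^ 2 + (n:ℝ) ^ 2 * ‖ψ r‖ ^ 2) * r := by
    refine setIntegral_nonneg measurableSet_Ioo fun r hr => ?_
    have := Ubar_lower h.hΦ h.hα hr
    have h2 : 0 ≤ Ubar Φ α r := by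
      refine le_trans (mul_nonneg (div_nonneg h.hΦ Real.pi_pos.le) ?_) this
      nlinarith [hr.1, hr.2]
    have := hr.1.le
    positivity
  generalize (∫ r in Set.Ioo (0:ℝ) 1, Ubar Φ α r * (‖P r‖ ^ 2 + (n:ℝ) ^ 2 * ‖ψ r‖ ^ 2) * r) = X at *
  generalize (∫ r in Set.Ioo (0:ℝ) 1, (r:ℂ) * (P r * conj (ψ r)) * (r:ℂ)) = d at *
  generalize (∫ r in Set.Ioo (0:ℝ) 1, (f r * conj (ψ r)) * (r:ℂ)) = e at *
  generalize (∫ r in Set.Ioo (0:ℝ) 1, ‖ω r - (n:ℂ) ^ 2 * ψ r‖ ^ 2 * r) = W at *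
  generalize (∫ r in Set.Ioo (0:ℝ) 1, r * (‖P r‖ * ‖ψ r‖) * r) = Y at *
  have hre := congrArg Complex.re e1
  have him := congrArg Complex.im e1
  simp [e3] at hre him
  have hc := cU_nonneg h.hΦ h.hα
  have b1 := (Complex.abs_re_le_norm e).trans hn
  have b2 := (Complex.abs_im_le_norm e).trans hn
  have b3 := (Complex.abs_im_le_norm d).trans hY
  constructor
  · have : |(n:ℝ)| * X = |e.im| := by
      have e7 : |(n:ℝ) * X| = |(n:ℝ)| * X := by rw [abs_mul, abs_of_nonneg hX0]
      rw [← e7, ← abs_neg]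
      congr 1; linarith
    rw [this]; exact b2
  · have b4 : |(n:ℝ) * (cU Φ α * d.im)| ≤ |(n:ℝ)| * (cU Φ α * Y) := by
      rw [abs_mul, abs_mul, abs_of_nonneg hc]
      gcongr
    have := neg_abs_le ((n:ℝ) * (cU Φ α * d.im))
    have := neg_abs_le e.re
    linarith

lemma Core.E5 (h : Core Φ α n f ψ P ω Q) :
    ∫ r in Set.Ioo (0:ℝ) 1, r ^ 2 * (‖ψ r‖ * ‖ψ r‖) * r
      ≤ ∫ r in Set.Ioo (0:ℝ) 1, ((1 - r ^ 2) * r) * (‖P r‖ * ‖ψ r‖) * r := by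
  have i1 := h.lψ.prod h.lψ (m := fun r => ((r ^ 2 : ℝ) : ℂ)) (K := 1) (by fun_prop)
      (fun r hr => by rw [Complex.norm_real]; exact abs_le_one_r2 hr)
  have i2 := h.lP.prod h.lψ (m := fun r => (((1 - r ^ 2) * r : ℝ) : ℂ)) (K := 1) (by fun_prop)
      (fun r hr => by rw [Complex.norm_real]; exact abs_le_one_rs hr)
  have i3 := h.lψ.prod h.lP (m := fun r => (((1 - r ^ 2) * r : ℝ) : ℂ)) (K := 1) (by fun_prop)
      (fun r hr => by rw [Complex.norm_real]; exact abs_le_one_rs hr)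
  have key := aux_ftc (F := fun r => (1 - (r:ℂ) * (r:ℂ)) * (((r:ℂ) * ψ r) * conj ((r:ℂ) * ψ r))) (B := 0) ?_
    ((i2.add i3).sub (i1.const_mul 2)) ?_ ?_
  · have e : (∫ r in Set.Ioo (0:ℝ) 1, (((1 - r ^ 2) * r : ℝ) : ℂ) * (ψ r * conj (P r)) * (r:ℂ))
        = conj (∫ r in Set.Ioo (0:ℝ) 1, (((1 - r ^ 2) * r : ℝ) : ℂ) * (P r * conj (ψ r)) * (r:ℂ)) := by
      rw [← integral_conj]
      congr 1; ext r
      simp only [map_mul, Complex.conj_conj, Complex.conj_ofReal]; ring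
    have e2 : ((∫ r in Set.Ioo (0:ℝ) 1, r ^ 2 * (‖ψ r‖ * ‖ψ r‖) * r : ℝ) : ℂ)
        = ∫ r in Set.Ioo (0:ℝ) 1, ((r ^ 2 : ℝ) : ℂ) * (ψ r * conj (ψ r)) * (r:ℂ) := by
      rw [← integral_complex_ofReal]
      congr 1; ext r
      rw [Complex.mul_conj, Complex.normSq_eq_norm_sq]; push_cast; ring
    have key2 : (∫ r in Set.Ioo (0:ℝ) 1, (((1 - r ^ 2) * r : ℝ) : ℂ) * (P r * conj (ψ r)) * (r:ℂ))
       + (∫ r in Set.Ioo (0:ℝ) 1, (((1 - r ^ 2) * r : ℝ) : ℂ) * (ψ r * conj (P r)) * (r:ℂ))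
       - 2 * ∫ r in Set.Ioo (0:ℝ) 1, ((r ^ 2 : ℝ) : ℂ) * (ψ r * conj (ψ r)) * (r:ℂ) = 0 := by
      rw [← integral_add i2 i3, ← integral_const_mul, ← integral_sub]
      · exact key
      · exact i2.add i3
      · exact i1.const_mul 2
    rw [e, ← e2] at key2
    have hre := congrArg Complex.re key2
    simp only [Complex.add_re, Complex.sub_re, Complex.conj_re, Complex.zero_re, Complex.mul_re,
      Complex.ofReal_re, Complex.ofReal_im, Complex.re_ofNat, Complex.im_ofNat, mul_zero,
      sub_zero] at hre
    have hY : ‖∫ r in Set.Ioo (0:ℝ) 1, (((1 - r ^ 2) * r : ℝ) : ℂ) * (P r * conj (ψ r)) * (r:ℂ)‖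
        ≤ ∫ r in Set.Ioo (0:ℝ) 1, ((1 - r ^ 2) * r) * (‖P r‖ * ‖ψ r‖) * r := by
      refine (norm_integral_le_integral_norm _).trans_eq ?_
      refine setIntegral_congr_fun measurableSet_Ioo fun r hr => ?_
      have : 0 ≤ (1 - r ^ 2) * r := mul_nonneg (by nlinarith [hr.1, hr.2]) hr.1.le
      simp only [norm_mul, Complex.norm_real, RCLike.norm_conj, Real.norm_eq_abs, abs_of_pos hr.1]
      rw [← abs_of_pos hr.1, ← abs_mul, abs_of_pos hr.1, abs_of_nonneg this]
    have := (Complex.abs_re_le_norm _).trans hY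
    have := (le_abs_self _).trans this
    linarith
  · intro r hr
    have hr0 : (r:ℂ) ≠ 0 := by exact_mod_cast hr.1.ne'
    have := (((HD.ofReal r).mul (HD.ofReal r)).const_sub 1).mul
      (((HD.ofReal r).mul (h.d1 r hr)).mul (HD.conj ((HD.ofReal r).mul (h.d1 r hr))))
    refine this.congr_deriv ?_
    simp only [map_sub, map_div₀, Complex.conj_ofReal, Pi.mul_apply, Pi.add_apply, Pi.sub_apply,
      map_mul, map_add, map_one]
    push_cast
    field_simp
    ring
  · simpa using (tendsto_const_nhds.sub (tend_r0.mul tend_r0)).mul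
      ((tend_r0.mul h.z1).mul (tend_conj (tend_r0.mul h.z1)))
  · simpa using (tendsto_const_nhds.sub (tend_r1.mul tend_r1)).mul
      ((tend_r1.mul h.o1).mul (tend_conj (tend_r1.mul h.o1)))

lemma Core.I5 (h : Core Φ α n f ψ P ω Q) (hn : n ≠ 0) :
    |(n:ℝ)| * (∫ r in Set.Ioo (0:ℝ) 1, ‖ψ r‖ ^ 2 * r)
      ≤ 3 / 2 * ((∫ r in Set.Ioo (0:ℝ) 1, (1 - r ^ 2) * ‖P r‖ ^ 2 * r)
        + (n:ℝ) ^ 2 * (∫ r in Set.Ioo (0:ℝ) 1, (1 - r ^ 2) * ‖ψ r‖ ^ 2 * r)) := by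
  have hn1 : 1 ≤ |(n:ℝ)| := by exact_mod_cast Int.one_le_abs hn
  have e5 := h.E5
  have i1 : IntegrableOn (fun r => r ^ 2 * (‖ψ r‖ * ‖ψ r‖) * r) (Set.Ioo 0 1) :=
    h.lψ.rprod h.lψ (m := fun r => r ^ 2) (K := 1) (by fun_prop) (fun r hr => abs_le_one_r2 hr)
  have i2 : IntegrableOn (fun r => ((1 - r ^ 2) * r) * (‖P r‖ * ‖ψ r‖) * r) (Set.Ioo 0 1) :=
    h.lP.rprod h.lψ (m := fun r => (1 - r ^ 2) * r) (K := 1) (by fun_prop)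
      (fun r hr => abs_le_one_rs hr)
  have e1 : (∫ r in Set.Ioo (0:ℝ) 1, ‖ψ r‖ ^ 2 * r)
      = (∫ r in Set.Ioo (0:ℝ) 1, r ^ 2 * (‖ψ r‖ * ‖ψ r‖) * r)
        + ∫ r in Set.Ioo (0:ℝ) 1, (1 - r ^ 2) * ‖ψ r‖ ^ 2 * r := by
    rw [← integral_add i1 h.iB]
    congr 1; ext r; ring
  have hB : 0 ≤ ∫ r in Set.Ioo (0:ℝ) 1, (1 - r ^ 2) * ‖ψ r‖ ^ 2 * r :=
    setIntegral_nonneg measurableSet_Ioo fun r hr =>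
      mul_nonneg (mul_nonneg (by nlinarith [hr.1, hr.2]) (by positivity)) hr.1.le
  have e2 : |(n:ℝ)| * ∫ r in Set.Ioo (0:ℝ) 1, ((1 - r ^ 2) * r) * (‖P r‖ * ‖ψ r‖) * r
      ≤ 1 / 2 * ((∫ r in Set.Ioo (0:ℝ) 1, (1 - r ^ 2) * ‖P r‖ ^ 2 * r)
        + (n:ℝ) ^ 2 * (∫ r in Set.Ioo (0:ℝ) 1, (1 - r ^ 2) * ‖ψ r‖ ^ 2 * r)) := by
    rw [← integral_const_mul, ← integral_const_mul, ← integral_add h.iA (h.iB.const_mul _),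
      ← integral_const_mul]
    refine setIntegral_mono_on (i2.const_mul _) ((h.iA.add (h.iB.const_mul _)).const_mul _)
      measurableSet_Ioo fun r hr => ?_
    have h0 : 0 ≤ (1 - r ^ 2) * r := mul_nonneg (by nlinarith [hr.1, hr.2]) hr.1.le
    have h1 : 2 * (|(n:ℝ)| * (r * (‖P r‖ * ‖ψ r‖))) ≤ ‖P r‖ ^ 2 + (n:ℝ) ^ 2 * ‖ψ r‖ ^ 2 := by
      have a : r * (‖P r‖ * ‖ψ r‖) ≤ ‖P r‖ * ‖ψ r‖ :=
        mul_le_of_le_one_left (by positivity) hr.2.le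
      have b := mul_le_mul_of_nonneg_left a (abs_nonneg (n:ℝ))
      nlinarith [sq_nonneg (‖P r‖ - |(n:ℝ)| * ‖ψ r‖), sq_abs (n:ℝ)]
    have := mul_le_mul_of_nonneg_left h1 h0
    linarith
  have e3 := mul_le_mul_of_nonneg_left e5 (abs_nonneg (n:ℝ))
  have e4 : |(n:ℝ)| ≤ (n:ℝ) ^ 2 := by rw [← sq_abs]; nlinarith
  have e6 := mul_le_mul_of_nonneg_right e4 hB
  have hA : 0 ≤ ∫ r in Set.Ioo (0:ℝ) 1, (1 - r ^ 2) * ‖P r‖ ^ 2 * r :=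
    setIntegral_nonneg measurableSet_Ioo fun r hr =>
      mul_nonneg (mul_nonneg (by nlinarith [hr.1, hr.2]) (by positivity)) hr.1.le
  rw [e1]
  linarith

lemma Core.pt (h : Core Φ α n f ψ P ω Q) {r : ℝ} (hr : r ∈ Set.Ioo (0:ℝ) 1) :
    r ^ 2 * ‖ψ r‖ ^ 2 ≤ (1 - r) * ∫ r in Set.Ioo (0:ℝ) 1, ‖P r‖ ^ 2 * r := by
  have hsub : Set.Ioo r 1 ⊆ Set.Ioo 0 1 := Set.Ioo_subset_Ioo_left hr.1.le
  have hc : ContinuousOn (fun t : ℝ => (t:ℂ) * P t) (Set.Ioo r 1) := by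
    have := h.lP.c.mono hsub
    fun_prop
  have hsq : IntegrableOn (fun t : ℝ => ‖(t:ℂ) * P t‖ ^ 2) (Set.Ioo r 1) := by
    refine Integrable.mono' (h.lP.i.mono_set hsub) ?_ ?_
    · exact (hc.norm.pow 2).aestronglyMeasurable measurableSet_Ioo
    · refine (ae_restrict_iff' measurableSet_Ioo).2 (Eventually.of_forall fun t ht => ?_)
      have ht' := hsub ht
      rw [Real.norm_of_nonneg (by positivity), norm_mul, Complex.norm_real, Real.norm_eq_abs,
        abs_of_pos ht'.1, mul_pow, mul_comm]
      gcongr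
      nlinarith [ht'.1, ht'.2]
  have h1i : IntegrableOn (fun _ : ℝ => (1:ℝ) ^ 2) (Set.Ioo r 1) := by simp
  have hni : IntegrableOn (fun t : ℝ => ‖(t:ℂ) * P t‖ * 1) (Set.Ioo r 1) := by
    refine Integrable.mono' (hsq.add h1i) ?_ ?_
    · exact (hc.norm.mul continuousOn_const).aestronglyMeasurable measurableSet_Ioo
    · refine Eventually.of_forall fun t => ?_
      simp only [Pi.add_apply, mul_one, norm_norm]
      nlinarith [sq_nonneg (‖(t:ℂ) * P t‖ - 1)]
  have hi : IntegrableOn (fun t : ℝ => (t:ℂ) * P t) (Set.Ioo r 1) := by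
    refine Integrable.mono' hni (hc.aestronglyMeasurable measurableSet_Ioo) ?_
    exact Eventually.of_forall fun t => by simp
  have hder : ∀ t ∈ Set.Ioo r 1, HasDerivAt (fun t : ℝ => (t:ℂ) * ψ t) ((t:ℂ) * P t) t := by
    intro t ht
    have hr0 : (t:ℂ) ≠ 0 := by exact_mod_cast (hsub ht).1.ne'
    refine ((HD.ofReal t).mul (h.d1 t (hsub ht))).congr_deriv ?_
    field_simp; ring
  have hcont : Tendsto (fun t : ℝ => (t:ℂ) * ψ t) (𝓝[>] r) (𝓝 ((r:ℂ) * ψ r)) :=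
    ((HD.ofReal r).mul (h.d1 r hr)).continuousAt.tendsto.mono_left nhdsWithin_le_nhds
  have h1 : Tendsto (fun t : ℝ => (t:ℂ) * ψ t) (𝓝[<] 1) (𝓝 0) := by
    simpa using tend_r1.mul h.o1
  have ftc := intervalIntegral.integral_eq_sub_of_hasDerivAt_of_tendsto hr.2 hder
    ((intervalIntegrable_iff_integrableOn_Ioo_of_le hr.2.le).2 hi) hcont h1
  rw [intervalIntegral.integral_of_le hr.2.le, integral_Ioc_eq_integral_Ioo, zero_sub] at ftc
  have b1 : r * ‖ψ r‖ ≤ ∫ t in Set.Ioo r 1, ‖(t:ℂ) * P t‖ * 1 := by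
    have := norm_integral_le_integral_norm (μ := volume.restrict (Set.Ioo r 1))
      (fun t : ℝ => (t:ℂ) * P t)
    rw [ftc] at this
    rw [norm_neg, norm_mul, Complex.norm_real, Real.norm_eq_abs, abs_of_pos hr.1] at this
    simpa using this
  have b2 := aux_cs hsq h1i hni
  have b3 : ∫ t in Set.Ioo r 1, (1:ℝ) ^ 2 = 1 - r := by
    simp [hr.2.le]
  have b4 : ∫ t in Set.Ioo r 1, ‖(t:ℂ) * P t‖ ^ 2 ≤ ∫ r in Set.Ioo (0:ℝ) 1, ‖P r‖ ^ 2 * r := by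
    calc _ ≤ ∫ t in Set.Ioo r 1, ‖P t‖ ^ 2 * t := by
          refine setIntegral_mono_on hsq (h.lP.i.mono_set hsub) measurableSet_Ioo fun t ht => ?_
          have ht' := hsub ht
          rw [norm_mul, Complex.norm_real, Real.norm_eq_abs, abs_of_pos ht'.1, mul_pow, mul_comm]
          gcongr
          nlinarith [ht'.1, ht'.2]
      _ ≤ _ := by
          refine setIntegral_mono_set h.lP.i ?_ hsub.eventuallyLE
          refine (ae_restrict_iff' measurableSet_Ioo).2 (Eventually.of_forall fun t ht => ?_)
          exact mul_nonneg (by positivity) ht.1.le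
  rw [b3] at b2
  have b5 : (r * ‖ψ r‖) ^ 2 ≤ (∫ t in Set.Ioo r 1, ‖(t:ℂ) * P t‖ * 1) ^ 2 :=
    pow_le_pow_left₀ (mul_nonneg hr.1.le (norm_nonneg _)) b1 2
  have b6 := mul_le_mul_of_nonneg_right b4 (sub_nonneg.2 hr.2.le)
  nlinarith

lemma Core.I6 (h : Core Φ α n f ψ P ω Q) {δ : ℝ} (hδ : 0 < δ) :
    (∫ r in Set.Ioo (0:ℝ) 1, r * (‖P r‖ * ‖ψ r‖) * r)
      ≤ 1 / 2 * (∫ r in Set.Ioo (0:ℝ) 1, (1 - r ^ 2) * ‖P r‖ ^ 2 * r)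
        + 1 / 2 * (1 / δ * (∫ r in Set.Ioo (0:ℝ) 1, ‖ψ r‖ ^ 2 * r)
          + δ * ∫ r in Set.Ioo (0:ℝ) 1, ‖P r‖ ^ 2 * r) := by
  have hD : 0 ≤ ∫ r in Set.Ioo (0:ℝ) 1, ‖P r‖ ^ 2 * r :=
    setIntegral_nonneg measurableSet_Ioo fun r hr => mul_nonneg (by positivity) hr.1.le
  have hpt := fun r hr => h.pt (r := r) hr
  generalize (∫ r in Set.Ioo (0:ℝ) 1, ‖P r‖ ^ 2 * r) = D at *
  have i0 : IntegrableOn ((Set.Ioo (1 - δ) 1).indicator fun _ => D) (Set.Ioo 0 1) :=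
    ((integrable_indicator_iff measurableSet_Ioo).2 (by simp)).integrableOn
  have hI : ∫ r in Set.Ioo (0:ℝ) 1, (Set.Ioo (1 - δ) 1).indicator (fun _ => D) r ≤ δ * D := by
    calc _ ≤ ∫ r, (Set.Ioo (1 - δ) 1).indicator (fun _ => D) r := by
          refine setIntegral_le_integral ((integrable_indicator_iff measurableSet_Ioo).2 (by simp)) ?_
          exact Eventually.of_forall fun r => Set.indicator_nonneg (fun _ _ => hD) r
      _ = δ * D := by
          rw [integral_indicator measurableSet_Ioo]
          simp [hδ.le]
  refine le_trans ?_ (add_le_add_right (mul_le_mul_of_nonneg_left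
    (add_le_add_right hI _) (by norm_num : (0:ℝ) ≤ 1 / 2)) _)
  rw [← integral_const_mul, ← integral_const_mul, ← integral_add (h.lψ.i.const_mul _) i0,
    ← integral_const_mul, ← integral_add]
  rotate_left
  · exact h.iA.const_mul _
  · exact ((h.lψ.i.const_mul _).add i0).const_mul _
  refine setIntegral_mono_on h.iY ((h.iA.const_mul _).add
      (((h.lψ.i.const_mul _).add i0).const_mul _)) measurableSet_Ioo fun r hr => ?_
  have hs : 0 < 1 - r ^ 2 := by nlinarith [hr.1, hr.2]
  have hr0 := hr.1
  have y1 : r * (‖P r‖ * ‖ψ r‖) * r ≤ 1 / 2 * ((1 - r ^ 2) * ‖P r‖ ^ 2 * r)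
      + 1 / 2 * (r ^ 3 * ‖ψ r‖ ^ 2 / (1 - r ^ 2)) := by
    have : r ^ 3 * ‖ψ r‖ ^ 2 / (1 - r ^ 2) + (1 - r ^ 2) * ‖P r‖ ^ 2 * r
        - 2 * (r * (‖P r‖ * ‖ψ r‖) * r)
        = r * (r * ‖ψ r‖ - (1 - r ^ 2) * ‖P r‖) ^ 2 / (1 - r ^ 2) := by
      field_simp; ring
    have h2 : 0 ≤ r * (r * ‖ψ r‖ - (1 - r ^ 2) * ‖P r‖) ^ 2 / (1 - r ^ 2) := by positivity
    linarith
  have y2 : r ^ 3 * ‖ψ r‖ ^ 2 / (1 - r ^ 2)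
      ≤ 1 / δ * (‖ψ r‖ ^ 2 * r) + (Set.Ioo (1 - δ) 1).indicator (fun _ => D) r := by
    by_cases hd : r ∈ Set.Ioo (1 - δ) 1
    · rw [Set.indicator_of_mem hd]
      have : 0 ≤ 1 / δ * (‖ψ r‖ ^ 2 * r) := by positivity
      have h3 : r ^ 3 * ‖ψ r‖ ^ 2 / (1 - r ^ 2) ≤ D := by
        rw [div_le_iff₀ hs]
        have h4 := mul_le_mul_of_nonneg_left (hpt r hr) hr0.le
        have h5 : 0 ≤ (1 - r) * D := mul_nonneg (by linarith [hr.2]) hD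
        nlinarith
      linarith
    · rw [Set.indicator_of_notMem hd, add_zero]
      have h3 : δ ≤ 1 - r := by
        by_contra hcon
        exact hd ⟨by linarith, hr.2⟩
      have h4 : δ ≤ 1 - r ^ 2 := by nlinarith [hr.2]
      calc r ^ 3 * ‖ψ r‖ ^ 2 / (1 - r ^ 2) ≤ r ^ 3 * ‖ψ r‖ ^ 2 / δ := by gcongr
        _ ≤ (r * ‖ψ r‖ ^ 2) / δ := by
          gcongr
          nlinarith [hr.2, mul_pos hr0 hr0]
        _ = _ := by ring
  linarith

end

lemma numeric {N X F s W D A B Y c Φ : ℝ} (hN : 1 ≤ N) (hF : 0 ≤ F) (hs : 0 ≤ s) (hW : 0 ≤ W)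
    (hD : 0 ≤ D) (hA : 0 ≤ A) (hB : 0 ≤ B) (hY : 0 ≤ Y) (hΦ : 0 ≤ Φ)
    (h1 : N * X ≤ F * s) (h2 : W ^ 2 ≤ N * (c * Y) + F * s)
    (h3 : N ^ 4 * s ^ 2 ≤ W ^ 2) (h3' : N ^ 2 * D ≤ W ^ 2) (h4 : Φ * (A + N ^ 2 * B) ≤ Real.pi * X)
    (h5 : N * s ^ 2 ≤ 3 / 2 * (A + N ^ 2 * B))
    (h6 : ∀ δ > 0, Y ≤ 1 / 2 * A + 1 / 2 * (1 / δ * s ^ 2 + δ * D))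
    (hc : c ≤ 4 * (Φ / Real.pi)) : N ^ 2 * W ≤ 10 * F := by
  have hN0 : 0 < N := by linarith
  have hpi := Real.pi_gt_three
  have hpi4 := Real.pi_lt_d2
  have hpi0 := Real.pi_pos
  have a1 : N ^ 2 * s ≤ W := by
    refine (pow_le_pow_iff_left₀ (by positivity) hW two_ne_zero).1 ?_
    calc _ = N ^ 4 * s ^ 2 := by ring
      _ ≤ _ := h3
  have a2 : N * (Φ * A) ≤ Real.pi * (F * s) := by
    have : Φ * A ≤ Φ * (A + N ^ 2 * B) := by
      gcongr; nlinarith [mul_nonneg (sq_nonneg N) hB]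
    calc N * (Φ * A) ≤ N * (Real.pi * X) := mul_le_mul_of_nonneg_left (this.trans h4) hN0.le
      _ = Real.pi * (N * X) := by ring
      _ ≤ _ := by gcongr
  have a3 : Φ * (N ^ 2 * s) ≤ 5 * F := by
    rcases hs.eq_or_lt with rfl | hs0
    · simpa using hF
    · have : Φ * (N ^ 2 * s) * s ≤ 5 * F * s := by
        calc Φ * (N ^ 2 * s) * s = N * (Φ * (N * s ^ 2)) := by ring
          _ ≤ N * (Φ * (3 / 2 * (A + N ^ 2 * B))) := by gcongr
          _ = N * (3 / 2 * (Φ * (A + N ^ 2 * B))) := by ring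
          _ ≤ N * (3 / 2 * (Real.pi * X)) := by gcongr
          _ = 3 / 2 * Real.pi * (N * X) := by ring
          _ ≤ 3 / 2 * Real.pi * (F * s) := by gcongr
          _ ≤ 5 * (F * s) := by
            have := mul_nonneg hF hs
            gcongr; linarith
          _ = _ := by ring
      exact le_of_mul_le_mul_right this hs0
  rcases hW.eq_or_lt with rfl | hW0
  · simpa using hF
  have a4 : N * (c * Y) ≤ N * (4 * (Φ / Real.pi) * Y) := by gcongr
  have a5 : 2 / Real.pi * (N * (Φ * A)) ≤ 2 * (F * s) := by
    rw [div_mul_eq_mul_div, div_le_iff₀ hpi0]; linarith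
  rcases hs.eq_or_lt with rfl | hs0
  · exfalso
    set k := N * (4 * (Φ / Real.pi)) * (1 / 2 * D) with hk
    have hk0 : 0 ≤ k := by positivity
    have h7 : ∀ δ > 0, W ^ 2 ≤ k * δ := by
      intro δ hδ
      have h8 := h6 δ hδ
      have h9 : N * (4 * (Φ / Real.pi) * Y)
          ≤ N * (4 * (Φ / Real.pi) * (1 / 2 * A + 1 / 2 * (1 / δ * 0 ^ 2 + δ * D))) := by gcongr
      have h10 : N * (4 * (Φ / Real.pi) * (1 / 2 * A + 1 / 2 * (1 / δ * 0 ^ 2 + δ * D)))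
         = 2 / Real.pi * (N * (Φ * A)) + k * δ := by rw [hk]; ring
      linarith
    have h8 := h7 (W ^ 2 / (2 * (k + 1))) (by positivity)
    have h9 : k * (W ^ 2 / (2 * (k + 1))) < W ^ 2 := by
      rw [← mul_div_assoc, div_lt_iff₀ (by positivity)]
      nlinarith [mul_nonneg hk0 (sq_nonneg W), pow_pos hW0 2]
    linarith
  · have h8 := h6 (N * s / W) (by positivity)
    have h9 : 1 / (N * s / W) * s ^ 2 = s * W / N := by field_simp
    have h10 : N * s / W * D ≤ s * W / N := by
      rw [div_mul_eq_mul_div, div_le_div_iff₀ hW0 hN0]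
      calc N * s * D * N = s * (N ^ 2 * D) := by ring
        _ ≤ s * W ^ 2 := by gcongr
        _ = _ := by ring
    have h11 : Y ≤ 1 / 2 * A + s * W / N := by linarith
    have h12 : N * (4 * (Φ / Real.pi) * Y) ≤ N * (4 * (Φ / Real.pi) * (1 / 2 * A + s * W / N)) := by
      gcongr
    have h13 : N * (4 * (Φ / Real.pi) * (1 / 2 * A + s * W / N))
        = 2 / Real.pi * (N * (Φ * A)) + 4 / Real.pi * (Φ * s * W) := by
      field_simp
      ring
    have h14 : 4 / Real.pi * (Φ * s * W) ≤ 4 / 3 * (Φ * s * W) := by gcongr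
    have h15 : W ^ 2 ≤ 3 * (F * s) + 4 / 3 * (Φ * s * W) := by linarith
    have h16 : N ^ 2 * W * W ≤ 10 * F * W := by
      calc N ^ 2 * W * W = N ^ 2 * W ^ 2 := by ring
        _ ≤ N ^ 2 * (3 * (F * s) + 4 / 3 * (Φ * s * W)) := by gcongr
        _ = 3 * F * (N ^ 2 * s) + 4 / 3 * (Φ * (N ^ 2 * s)) * W := by ring
        _ ≤ 3 * F * W + 4 / 3 * (5 * F) * W := by gcongr
        _ ≤ 10 * F * W := by nlinarith [mul_nonneg hF hW]
    exact le_of_mul_le_mul_right h16 hW0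

section
variable {Φ α : ℝ} {n : ℤ} {f ψ P ω Q : ℝ → ℂ}

lemma wnn (u : ℝ → ℂ) : 0 ≤ ∫ r in Set.Ioo (0:ℝ) 1, ‖u r‖ ^ 2 * r :=
  setIntegral_nonneg measurableSet_Ioo fun r hr => mul_nonneg (by positivity) hr.1.le

lemma Core.I4 (h : Core Φ α n f ψ P ω Q) :
    Φ * ((∫ r in Set.Ioo (0:ℝ) 1, (1 - r ^ 2) * ‖P r‖ ^ 2 * r)
        + (n:ℝ) ^ 2 * (∫ r in Set.Ioo (0:ℝ) 1, (1 - r ^ 2) * ‖ψ r‖ ^ 2 * r))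
    ≤ Real.pi * ∫ r in Set.Ioo (0:ℝ) 1, Ubar Φ α r * (‖P r‖ ^ 2 + (n:ℝ) ^ 2 * ‖ψ r‖ ^ 2) * r := by
  rw [← integral_const_mul, ← integral_add h.iA (h.iB.const_mul _), ← integral_const_mul,
    ← integral_const_mul]
  refine setIntegral_mono_on ((h.iA.add (h.iB.const_mul _)).const_mul _) (h.iX.const_mul _)
    measurableSet_Ioo fun r hr => ?_
  have h1 := Ubar_lower h.hΦ h.hα hr
  have h2 : Φ * (1 - r ^ 2) ≤ Real.pi * Ubar Φ α r := by
    have := mul_le_mul_of_nonneg_left h1 Real.pi_pos.le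
    have e : Real.pi * (Φ / Real.pi * (1 - r ^ 2)) = Φ * (1 - r ^ 2) := by
      field_simp
    linarith
  have h3 : 0 ≤ (‖P r‖ ^ 2 + (n:ℝ) ^ 2 * ‖ψ r‖ ^ 2) * r :=
    mul_nonneg (by positivity) hr.1.le
  have := mul_le_mul_of_nonneg_right h2 h3
  linarith

lemma Core.main (h : Core Φ α n f ψ P ω Q) :
    (n:ℝ) ^ 4 * (∫ r in Set.Ioo (0:ℝ) 1, ‖ω r - (n:ℂ) ^ 2 * ψ r‖ ^ 2 * r)
      ≤ 100 * ∫ r in Set.Ioo (0:ℝ) 1, ‖f r‖ ^ 2 * r := by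
  have hF := wnn f
  by_cases hn : n = 0
  · subst hn; simpa using hF
  have hn1 : 1 ≤ |(n:ℝ)| := by exact_mod_cast Int.one_le_abs hn
  have hW := wnn (fun r => ω r - (n:ℂ) ^ 2 * ψ r)
  have hO := wnn ω
  have hP := wnn P
  have hψ := wnn ψ
  have hA : 0 ≤ ∫ r in Set.Ioo (0:ℝ) 1, (1 - r ^ 2) * ‖P r‖ ^ 2 * r :=
    setIntegral_nonneg measurableSet_Ioo fun r hr =>
      mul_nonneg (mul_nonneg (by nlinarith [hr.1, hr.2]) (by positivity)) hr.1.le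
  have hB : 0 ≤ ∫ r in Set.Ioo (0:ℝ) 1, (1 - r ^ 2) * ‖ψ r‖ ^ 2 * r :=
    setIntegral_nonneg measurableSet_Ioo fun r hr =>
      mul_nonneg (mul_nonneg (by nlinarith [hr.1, hr.2]) (by positivity)) hr.1.le
  have hY : 0 ≤ ∫ r in Set.Ioo (0:ℝ) 1, r * (‖P r‖ * ‖ψ r‖) * r :=
    setIntegral_nonneg measurableSet_Ioo fun r hr =>
      mul_nonneg (mul_nonneg hr.1.le (by positivity)) hr.1.le
  obtain ⟨h1, h2⟩ := h.I12
  have h3 := h.E4'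
  have hn4 : |(n:ℝ)| ^ 4 = (n:ℝ) ^ 4 := by
    rw [← abs_pow]; exact abs_of_nonneg (by positivity)
  have k1 : 0 ≤ (n:ℝ) ^ 2 * ∫ r in Set.Ioo (0:ℝ) 1, ‖P r‖ ^ 2 * r := by positivity
  have k2 : 0 ≤ (n:ℝ) ^ 4 * ∫ r in Set.Ioo (0:ℝ) 1, ‖ψ r‖ ^ 2 * r := by positivity
  have key := numeric hn1 (Real.sqrt_nonneg (∫ r in Set.Ioo (0:ℝ) 1, ‖f r‖ ^ 2 * r))
    (Real.sqrt_nonneg (∫ r in Set.Ioo (0:ℝ) 1, ‖ψ r‖ ^ 2 * r))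
    (Real.sqrt_nonneg (∫ r in Set.Ioo (0:ℝ) 1, ‖ω r - (n:ℂ) ^ 2 * ψ r‖ ^ 2 * r))
    hP hA hB hY h.hΦ h1 (by rw [Real.sq_sqrt hW]; exact h2)
    (by rw [Real.sq_sqrt hW, Real.sq_sqrt hψ, hn4]; linarith)
    (by rw [Real.sq_sqrt hW, sq_abs]; linarith)
    (by rw [sq_abs]; exact h.I4)
    (by rw [Real.sq_sqrt hψ, sq_abs]; exact h.I5 hn)
    (fun δ hδ => by rw [Real.sq_sqrt hψ]; exact h.I6 hδ)
    (cU_le h.hΦ h.hα)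
  have := pow_le_pow_left₀ (by positivity) key 2
  rw [mul_pow, mul_pow, Real.sq_sqrt hW, Real.sq_sqrt hF, sq_abs] at this
  linarith

end

lemma wInt_eq {h : ℝ → ℝ} (hi : IntegrableOn h (Set.Ioo 0 1)) (h0 : ∀ r ∈ Set.Ioo (0:ℝ) 1, 0 ≤ h r) :
    wInt h = ENNReal.ofReal (∫ r in Set.Ioo (0:ℝ) 1, h r) := by
  unfold wInt
  rw [ofReal_integral_eq_lintegral_ofReal hi]
  exact (ae_restrict_iff' measurableSet_Ioo).2 (Eventually.of_forall h0)

lemma wInt_integrable {h : ℝ → ℝ} (hc : ContinuousOn h (Set.Ioo 0 1))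
    (h0 : ∀ r ∈ Set.Ioo (0:ℝ) 1, 0 ≤ h r) (hf : wInt h < ⊤) : IntegrableOn h (Set.Ioo 0 1) := by
  refine ⟨hc.aestronglyMeasurable measurableSet_Ioo, ?_⟩
  rw [hasFiniteIntegral_iff_ofReal
    ((ae_restrict_iff' measurableSet_Ioo).2 (Eventually.of_forall h0))]
  exact hf

lemma wInt_congr {h g : ℝ → ℝ} (e : ∀ r ∈ Set.Ioo (0:ℝ) 1, h r = g r) : wInt h = wInt g := by
  unfold wInt
  exact setLIntegral_congr_fun measurableSet_Ioo fun r hr => by simp only [e r hr]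

lemma wInt_mono {h g : ℝ → ℝ} (e : ∀ r ∈ Set.Ioo (0:ℝ) 1, h r ≤ g r) : wInt h ≤ wInt g := by
  unfold wInt
  exact setLIntegral_mono' measurableSet_Ioo fun r hr => ENNReal.ofReal_le_ofReal (e r hr)

lemma L2r.of {u : ℝ → ℂ} (hc : ContinuousOn u (Set.Ioo 0 1))
    (hf : wInt (fun r => ‖u r‖ ^ 2 * r) < ⊤) : L2r u := by
  refine ⟨hc, wInt_integrable (by fun_prop) (fun r hr => mul_nonneg (by positivity) hr.1.le) hf⟩

lemma L2r.wInt {u : ℝ → ℂ} (h : L2r u) :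
    wInt (fun r => ‖u r‖ ^ 2 * r) = ENNReal.ofReal (∫ r in Set.Ioo (0:ℝ) 1, ‖u r‖ ^ 2 * r) :=
  wInt_eq h.i (fun r hr => mul_nonneg (by positivity) hr.1.le)

section
variable {Φ α : ℝ} {n : ℤ} {f ψ P ω Q : ℝ → ℂ}

lemma uI : UniqueDiffOn ℝ (Set.Ioc (0:ℝ) 1) := uniqueDiffOn_Ioc 0 1

lemma dz_contDiff {g : ℝ → ℂ} {m k : ℕ} (h : ContDiffOn ℝ k g (Set.Ioc 0 1)) (hk : m + 1 ≤ k) :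
    ContDiffOn ℝ m (dz g) (Set.Ioc 0 1) :=
  h.derivWithin uI (by exact_mod_cast hk)

lemma dz_has {g : ℝ → ℂ} (h : ContDiffOn ℝ 1 g (Set.Ioc 0 1)) {r : ℝ} (hr : r ∈ Set.Ioc (0:ℝ) 1) :
    HasDerivWithinAt g (dz g r) (Set.Ioc 0 1) r :=
  ((h.differentiableOn one_ne_zero) r hr).hasDerivWithinAt

lemma dz_hasAt {g : ℝ → ℂ} (h : ContDiffOn ℝ 1 g (Set.Ioc 0 1)) {r : ℝ} (hr : r ∈ Set.Ioo (0:ℝ) 1) :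
    HasDerivAt g (dz g r) r :=
  (dz_has h ⟨hr.1, hr.2.le⟩).hasDerivAt (Ioc_mem_nhds hr.1 hr.2)

lemma dz_rmul {g : ℝ → ℂ} (h : ContDiffOn ℝ 1 g (Set.Ioc 0 1)) {r : ℝ} (hr : r ∈ Set.Ioc (0:ℝ) 1) :
    dz (fun s : ℝ => (s:ℂ) * g s) r = (r:ℂ) * (dz g r + g r / r) := by
  have hr0 : (r:ℂ) ≠ 0 := by exact_mod_cast hr.1.ne'
  have := ((HD.ofReal r).hasDerivWithinAt.mul (dz_has h hr)).derivWithin (uI r hr)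
  refine Eq.trans this ?_
  field_simp; ring

lemma dz_lin {g k : ℝ → ℂ} (hg : ContDiffOn ℝ 1 g (Set.Ioc 0 1)) (hk : ContDiffOn ℝ 1 k (Set.Ioc 0 1))
    (c : ℂ) {r : ℝ} (hr : r ∈ Set.Ioc (0:ℝ) 1) :
    dz (fun s => g s - c * k s) r = dz g r - c * dz k r :=
  ((dz_has hg hr).sub ((dz_has hk hr).const_mul c)).derivWithin (uI r hr)

lemma Lop_lin {g k : ℝ → ℂ} (hg : ContDiffOn ℝ 2 g (Set.Ioc 0 1)) (hk : ContDiffOn ℝ 2 k (Set.Ioc 0 1))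
    (c : ℂ) {r : ℝ} (hr : r ∈ Set.Ioc (0:ℝ) 1) :
    Lop (fun s => g s - c * k s) r = Lop g r - c * Lop k r := by
  have hg1 : ContDiffOn ℝ 1 g (Set.Ioc 0 1) := hg.of_le (by norm_num)
  have hk1 : ContDiffOn ℝ 1 k (Set.Ioc 0 1) := hk.of_le (by norm_num)
  have e1 := dz_lin hg1 hk1 c hr
  have e2 : dz (dz (fun s => g s - c * k s)) r = dz (dz g) r - c * dz (dz k) r := by
    rw [← dz_lin (dz_contDiff (m := 1) (k := 2) hg le_rfl) (dz_contDiff (m := 1) (k := 2) hk le_rfl) c hr]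
    exact derivWithin_congr (fun s hs => dz_lin hg1 hk1 c hs) e1
  unfold Lop
  rw [e1, e2]; ring

lemma Lop_contDiff {g : ℝ → ℂ} (hg : ContDiffOn ℝ 4 g (Set.Ioc 0 1)) :
    ContDiffOn ℝ 2 (Lop g) (Set.Ioc 0 1) := by
  have h1 : ContDiffOn ℝ 3 (dz g) (Set.Ioc 0 1) := dz_contDiff (m := 3) (k := 4) hg le_rfl
  have h2 : ContDiffOn ℝ 2 (dz (dz g)) (Set.Ioc 0 1) := dz_contDiff (m := 2) (k := 3) h1 le_rfl
  have hr : ContDiffOn ℝ 2 (fun r : ℝ => (r:ℂ)) (Set.Ioc 0 1) :=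
    Complex.ofRealCLM.contDiff.contDiffOn
  have hr0 : ∀ r ∈ Set.Ioc (0:ℝ) 1, (r:ℂ) ≠ 0 := fun r hr => by exact_mod_cast hr.1.ne'
  exact (h2.add ((hr.inv hr0).mul (h1.of_le (by norm_num)))).sub
    (((hr.pow 2).inv (fun r h => pow_ne_zero 2 (hr0 r h))).mul (hg.of_le (by norm_num)))

/-- the averaged derivative `(r g)'/r` has derivative `𝓛 g` -/
lemma avg_hasAt {g : ℝ → ℂ} (hg : ContDiffOn ℝ 2 g (Set.Ioc 0 1)) {r : ℝ}
    (hr : r ∈ Set.Ioo (0:ℝ) 1) : HasDerivAt (fun r : ℝ => dz g r + g r / r) (Lop g r) r := by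
  have hr0 : (r:ℂ) ≠ 0 := by exact_mod_cast hr.1.ne'
  have := (dz_hasAt (dz_contDiff (m := 1) (k := 2) hg le_rfl) hr).add
    ((dz_hasAt (hg.of_le (by norm_num)) hr).div (HD.ofReal r) hr0)
  refine this.congr_deriv ?_
  unfold Lop
  field_simp; ring

lemma lim_one {g : ℝ → ℂ} (hg : ContinuousOn g (Set.Ioc 0 1)) : Tendsto g (𝓝[<] 1) (𝓝 (g 1)) := by
  have h := (hg 1 ⟨by norm_num, le_rfl⟩).mono Set.Ioo_subset_Ioc_self
  unfold ContinuousWithinAt at h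
  rwa [nhdsWithin_Ioo_eq_nhdsLT (by norm_num)] at h

lemma NavierSol.core (hΦ : 0 ≤ Φ) (hα : 0 ≤ α) (hf : ContinuousOn f (Set.Ioo 0 1))
    (hff : wInt (fun r => ‖f r‖ ^ 2 * r) < ⊤) (h : NavierSol Φ α n f ψ) :
    Core Φ α n f ψ (fun r => dz ψ r + ψ r / r) (Lop ψ) (fun r => dz (Lop ψ) r + Lop ψ r / r) := by
  have c4 := h.smooth
  have c2 : ContDiffOn ℝ 2 ψ (Set.Ioc 0 1) := c4.of_le (by norm_num)
  have c1 : ContDiffOn ℝ 1 ψ (Set.Ioc 0 1) := c4.of_le (by norm_num)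
  have l2 := Lop_contDiff c4
  have l1 : ContDiffOn ℝ 1 (Lop ψ) (Set.Ioc 0 1) := l2.of_le (by norm_num)
  have cd : ContinuousOn (dz ψ) (Set.Ioc 0 1) :=
    (dz_contDiff (m := 1) (k := 2) c2 le_rfl).continuousOn
  have cdl : ContinuousOn (dz (Lop ψ)) (Set.Ioc 0 1) :=
    (dz_contDiff (m := 1) (k := 2) l2 le_rfl).continuousOn
  have hr0 : ∀ r ∈ Set.Ioc (0:ℝ) 1, (r:ℂ) ≠ 0 := fun r hr => by exact_mod_cast hr.1.ne'
  have cP : ContinuousOn (fun r : ℝ => dz ψ r + ψ r / r) (Set.Ioc 0 1) :=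
    cd.add (c1.continuousOn.div Complex.continuous_ofReal.continuousOn hr0)
  have cQ : ContinuousOn (fun r : ℝ => dz (Lop ψ) r + Lop ψ r / r) (Set.Ioc 0 1) :=
    cdl.add (l1.continuousOn.div Complex.continuous_ofReal.continuousOn hr0)
  have e0 : 𝓝[Set.Ioc (0:ℝ) 1] 0 = 𝓝[>] 0 := nhdsWithin_Ioc_eq_nhdsGT (by norm_num)
  have z := h.ext_psi
  have z' := h.ext_dpsi
  have zl := h.ext_Lpsi
  have zl' := h.ext_dLpsi
  rw [e0] at z z' zl zl'
  have ev : ∀ᶠ r in 𝓝[>] (0:ℝ), r ∈ Set.Ioc (0:ℝ) 1 := Ioc_mem_nhdsGT (by norm_num)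
  refine ⟨hΦ, hα, ?_, ?_, ?_, ?_, .of hf hff, .of ?_ h.fin_psi, .of ?_ ?_, .of ?_ h.fin_Lpsi, z, ?_,
    zl, ?_, ?_, ⟨dz ψ 1, ?_, ?_⟩, ⟨_, lim_one cQ⟩⟩
  · intro r hr
    simpa using dz_hasAt c1 hr
  · intro r hr
    exact avg_hasAt c2 hr
  · intro r hr
    simpa using dz_hasAt l1 hr
  · intro r hr
    refine (avg_hasAt l2 hr).congr_deriv ?_
    have := h.eqn r hr
    rw [Lop_lin l2 c2 _ ⟨hr.1, hr.2.le⟩] at this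
    linear_combination -this
  · exact c1.continuousOn.mono Set.Ioo_subset_Ioc_self
  · exact cP.mono Set.Ioo_subset_Ioc_self
  · have := h.fin_dpsi
    rwa [wInt_congr (g := fun r => ‖dz ψ r + ψ r / r‖ ^ 2 * r)] at this
    intro r hr
    rw [dz_rmul c1 ⟨hr.1, hr.2.le⟩, norm_mul, Complex.norm_real, Real.norm_eq_abs,
      abs_of_pos hr.1]
    have := hr.1.ne'
    field_simp
  · exact l1.continuousOn.mono Set.Ioo_subset_Ioc_self
  · obtain ⟨l, hl⟩ := z'
    have := (tend_r0.mul hl).add z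
    simp only [zero_mul, zero_add] at this
    refine this.congr' ?_
    filter_upwards [ev] with r hr
    have := hr0 r hr
    field_simp
  · obtain ⟨l, hl⟩ := zl'
    refine ⟨l, hl.congr' ?_⟩
    filter_upwards [ev] with r hr
    exact dz_rmul l1 hr
  · have := lim_one c1.continuousOn
    rwa [h.bc_psi] at this
  · have := lim_one cP
    simpa [h.bc_psi] using this
  · have := lim_one l1.continuousOn
    rwa [h.bc_navier] at this

end

end core

/-- Lemma B.2: higher-order a priori estimates of the stream function in terms of `f`,
uniform in `Φ ≥ 0`, `α ≥ 0` and `n`. -/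
theorem stream_apriori_estimates_higher :
    ∃ C : ℝ, 0 < C ∧ ∀ (Φ α : ℝ) (n : ℤ) (f ψ : ℝ → ℂ),
      0 ≤ Φ → 0 ≤ α →
      ContinuousOn f (Set.Ioo 0 1) → wInt (fun r => ‖f r‖ ^ 2 * r) < ⊤ →
      NavierSol Φ α n f ψ →
      ENNReal.ofReal ((n : ℝ) ^ 4) * wInt (fun r => ‖Lop ψ r‖ ^ 2 * r)
        + ENNReal.ofReal ((n : ℝ) ^ 6)
            * wInt (fun r => ‖dz (fun s => (s : ℂ) * ψ s) r‖ ^ 2 / r)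
        + ENNReal.ofReal ((n : ℝ) ^ 8) * wInt (fun r => ‖ψ r‖ ^ 2 * r)
          ≤ ENNReal.ofReal (C * (1 + Φ)) * wInt (fun r => ‖f r‖ ^ 2 * r) ∧
      wInt (fun r => ‖Lop (Lop ψ) r‖ ^ 2 * r)
          ≤ ENNReal.ofReal (C * (1 + Φ ^ 2)) * wInt (fun r => ‖f r‖ ^ 2 * r) := by
  refine ⟨1000, by norm_num, ?_⟩
  intro Φ α n f ψ hΦ hα hf hff h
  have hc := h.core hΦ hα hf hff
  have hF := wnn f
  have hO := wnn (Lop ψ)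
  have hP := wnn (fun r => dz ψ r + ψ r / r)
  have hp := wnn ψ
  have hW := wnn (fun r => Lop ψ r - (n:ℂ) ^ 2 * ψ r)
  have key := hc.main
  have e4 := hc.E4'
  have c1 : ContDiffOn ℝ 1 ψ (Set.Ioc 0 1) := h.smooth.of_le (by norm_num)
  have c2 : ContDiffOn ℝ 2 ψ (Set.Ioc 0 1) := h.smooth.of_le (by norm_num)
  have l2 := Lop_contDiff h.smooth
  have eP : wInt (fun r => ‖dz (fun s => (s : ℂ) * ψ s) r‖ ^ 2 / r)
      = wInt (fun r => ‖dz ψ r + ψ r / r‖ ^ 2 * r) := by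
    apply wInt_congr
    intro r hr
    rw [dz_rmul c1 ⟨hr.1, hr.2.le⟩, norm_mul, Complex.norm_real, Real.norm_eq_abs,
      abs_of_pos hr.1]
    have := hr.1.ne'
    field_simp
  constructor
  · rw [eP, hc.lω.wInt, hc.lP.wInt, hc.lψ.wInt, hc.lf.wInt]
    rw [← ENNReal.ofReal_mul (by positivity), ← ENNReal.ofReal_mul (by positivity),
      ← ENNReal.ofReal_mul (by positivity), ← ENNReal.ofReal_mul (by positivity),
      ← ENNReal.ofReal_add (by positivity) (by positivity),
      ← ENNReal.ofReal_add (by positivity) (by positivity)]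
    apply ENNReal.ofReal_le_ofReal
    rw [e4] at key
    have k1 : 0 ≤ (n:ℝ) ^ 6 * ∫ r in Set.Ioo (0:ℝ) 1, ‖dz ψ r + ψ r / r‖ ^ 2 * r := by positivity
    have k2 := mul_nonneg hΦ hF
    nlinarith
  · have hpt : ∀ r ∈ Set.Ioo (0:ℝ) 1, ‖Lop (Lop ψ) r‖ ^ 2 * r
        ≤ 4 * ((n:ℝ) ^ 4 * (‖Lop ψ r‖ ^ 2 * r)
          + ((n:ℝ) ^ 4 * (1 + Φ ^ 2)) * (‖Lop ψ r - (n:ℂ) ^ 2 * ψ r‖ ^ 2 * r)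
          + ‖f r‖ ^ 2 * r) := by
      intro r hr
      have e := h.eqn r hr
      rw [Lop_lin l2 c2 _ ⟨hr.1, hr.2.le⟩] at e
      have e1 : Lop (Lop ψ) r = (n:ℂ) ^ 2 * Lop ψ r + (n:ℂ) ^ 2 * (Lop ψ r - (n:ℂ) ^ 2 * ψ r)
          + Complex.I * (n:ℂ) * (Ubar Φ α r : ℂ) * (Lop ψ r - (n:ℂ) ^ 2 * ψ r) - f r := by
        linear_combination -e
      generalize hw : Lop ψ r - (n:ℂ) ^ 2 * ψ r = w at e1 ⊢
      have hU := Ubar_upper hΦ hα hr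
      have hn2 : (n:ℝ) ^ 2 ≤ (n:ℝ) ^ 4 := by
        have : n ^ 2 ≤ n ^ 4 := by
          rcases eq_or_ne n 0 with rfl | hn
          · norm_num
          · have : 1 ≤ n ^ 2 := Int.one_le_abs (pow_ne_zero 2 hn) |>.trans_eq (abs_of_nonneg (sq_nonneg n))
            nlinarith
        exact_mod_cast this
      have b1 : ‖Lop (Lop ψ) r‖ ≤ (n:ℝ) ^ 2 * ‖Lop ψ r‖ + (n:ℝ) ^ 2 * ‖w‖
          + |(n:ℝ)| * Φ * ‖w‖ + ‖f r‖ := by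
        rw [e1]
        refine (norm_sub_le _ _).trans (add_le_add_left ?_ _)
        refine (norm_add_le _ _).trans (add_le_add ((norm_add_le _ _).trans ?_) ?_)
        · simp
        · simp only [norm_mul, Complex.norm_I, one_mul, Complex.norm_intCast, Complex.norm_real,
            Real.norm_eq_abs]
          gcongr
      have b2 : ‖Lop (Lop ψ) r‖ ^ 2 ≤ 4 * (((n:ℝ) ^ 2 * ‖Lop ψ r‖) ^ 2 + ((n:ℝ) ^ 2 * ‖w‖) ^ 2
          + (|(n:ℝ)| * Φ * ‖w‖) ^ 2 + ‖f r‖ ^ 2) := by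
        refine (pow_le_pow_left₀ (norm_nonneg _) b1 2).trans ?_
        generalize (n:ℝ) ^ 2 * ‖Lop ψ r‖ = a
        generalize (n:ℝ) ^ 2 * ‖w‖ = b
        generalize |(n:ℝ)| * Φ * ‖w‖ = c
        generalize ‖f r‖ = d
        nlinarith [sq_nonneg (a - b), sq_nonneg (a - c), sq_nonneg (a - d), sq_nonneg (b - c),
          sq_nonneg (b - d), sq_nonneg (c - d)]
      have b3 : (|(n:ℝ)| * Φ * ‖w‖) ^ 2 ≤ (n:ℝ) ^ 4 * (Φ ^ 2 * ‖w‖ ^ 2) := by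
        rw [mul_pow, mul_pow, sq_abs, mul_assoc]
        gcongr
      have b4 : ‖Lop (Lop ψ) r‖ ^ 2 ≤ 4 * ((n:ℝ) ^ 4 * ‖Lop ψ r‖ ^ 2
          + ((n:ℝ) ^ 4 * (1 + Φ ^ 2)) * ‖w‖ ^ 2 + ‖f r‖ ^ 2) := by
        nlinarith
      calc _ ≤ 4 * ((n:ℝ) ^ 4 * ‖Lop ψ r‖ ^ 2
          + ((n:ℝ) ^ 4 * (1 + Φ ^ 2)) * ‖w‖ ^ 2 + ‖f r‖ ^ 2) * r :=
            mul_le_mul_of_nonneg_right b4 hr.1.le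
        _ = _ := by ring
    have i1 : IntegrableOn (fun r => (n:ℝ) ^ 4 * (‖Lop ψ r‖ ^ 2 * r)) (Set.Ioo 0 1) :=
      hc.lω.i.const_mul _
    have i2 : IntegrableOn (fun r => ((n:ℝ) ^ 4 * (1 + Φ ^ 2)) *
      (‖Lop ψ r - (n:ℂ) ^ 2 * ψ r‖ ^ 2 * r)) (Set.Ioo 0 1) := hc.lw.i.const_mul _
    have i12 : IntegrableOn (fun r => (n:ℝ) ^ 4 * (‖Lop ψ r‖ ^ 2 * r)
      + ((n:ℝ) ^ 4 * (1 + Φ ^ 2)) * (‖Lop ψ r - (n:ℂ) ^ 2 * ψ r‖ ^ 2 * r))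
      (Set.Ioo 0 1) := i1.add i2
    have i123 : IntegrableOn (fun r => 4 * ((n:ℝ) ^ 4 * (‖Lop ψ r‖ ^ 2 * r)
      + ((n:ℝ) ^ 4 * (1 + Φ ^ 2)) * (‖Lop ψ r - (n:ℂ) ^ 2 * ψ r‖ ^ 2 * r)
      + ‖f r‖ ^ 2 * r)) (Set.Ioo 0 1) := (i12.add hc.lf.i).const_mul 4
    refine (wInt_mono hpt).trans ?_
    rw [wInt_eq i123, hc.lf.wInt,
      ← ENNReal.ofReal_mul (by positivity)]
    · apply ENNReal.ofReal_le_ofReal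
      rw [integral_const_mul, integral_add i12 hc.lf.i, integral_add i1 i2,
        integral_const_mul, integral_const_mul]
      have hn4 : 0 ≤ (n:ℝ) ^ 4 := by positivity
      have k1 : (n:ℝ) ^ 4 * (∫ r in Set.Ioo (0:ℝ) 1, ‖Lop ψ r‖ ^ 2 * r)
          ≤ (n:ℝ) ^ 4 * ∫ r in Set.Ioo (0:ℝ) 1, ‖Lop ψ r - (n:ℂ) ^ 2 * ψ r‖ ^ 2 * r := by
        refine mul_le_mul_of_nonneg_left ?_ hn4
        rw [e4]
        have : 0 ≤ 2 * (n:ℝ) ^ 2 * ∫ r in Set.Ioo (0:ℝ) 1, ‖dz ψ r + ψ r / r‖ ^ 2 * r := by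
          positivity
        have : 0 ≤ (n:ℝ) ^ 4 * ∫ r in Set.Ioo (0:ℝ) 1, ‖ψ r‖ ^ 2 * r := by positivity
        linarith
      have k2 := mul_le_mul_of_nonneg_left key (by positivity : 0 ≤ 1 + Φ ^ 2)
      have k3 : 0 ≤ Φ ^ 2 * ∫ r in Set.Ioo (0:ℝ) 1, ‖f r‖ ^ 2 * r := by positivity
      linarith
    · intro r hr
      have := hr.1.le
      positivity
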